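/- arXiv:2004.11896 — 3 statements merged into one kernel-verified Lean document; each statement's English description precedes it below -/
import Mathlib

section
/- Let m ≥ 4 be even. Let f_{k,α,β} be an APN Taniguchi function on F_{2^m} × F_{2^m} with α ≠ 0, and let g_{ℓ,s,γ} be an APN Pott-Zhou function on F_{2^m} × F_{2^m} (gcd(ℓ,m) = 1, s even, γ a non-cube). Then f_{k,α,β} and g_{ℓ,s,γ} are CCZ-inequivalent. -/
/-- The Taniguchi function `f_{k,α,β}` on `K × K`. -/
def taniguchi {K : Type*} [Field K] (k : ℕ) (α β : K) : K × K → K × K :=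
  fun p => (p.1 ^ (2 ^ (2 * k) * (2 ^ k + 1)) + α * p.1 ^ (2 ^ (2 * k)) * p.2 ^ (2 ^ k)
      + β * p.2 ^ (2 ^ k + 1), p.1 * p.2)

/-- The Pott-Zhou function `g_{ℓ,s,γ}` on `K × K`. -/
def pottZhou {K : Type*} [Field K] (ℓ s : ℕ) (γ : K) : K × K → K × K :=
  fun p => (p.1 ^ (2 ^ ℓ + 1) + γ * p.2 ^ (2 ^ s * (2 ^ ℓ + 1)), p.1 * p.2)

/-- Two functions `f, g` on a finite-dimensional `F_2`-vector space `V` are CCZ-equivalent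
if some affine permutation of `V × V` (an `F_2`-linear bijection composed with a
translation) maps the graph of `f` onto the graph of `g`. -/
def CCZEquivalent {V : Type*} [AddCommGroup V] [Module (ZMod 2) V] (f g : V → V) : Prop :=
  ∃ (A : V × V → V × V) (c : V × V), IsLinearMap (ZMod 2) A ∧ Function.Bijective A ∧
    (fun p => A p + c) '' {p : V × V | p.2 = f p.1} = {p : V × V | p.2 = g p.1}

namespace TPZ

section Yoshiara

variable {Ω : Type*} [AddCommGroup Ω]

/-- Affine permutations (over `F_2`) stabilising the set `G`. -/
def HG (G : Set Ω) : Subgroup (Equiv.Perm Ω) where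
  carrier := {h | (∀ x y z, h (x + y + z) = h x + h y + h z) ∧ ∀ x, h x ∈ G ↔ x ∈ G}
  mul_mem' := by
    rintro a b ⟨ha, ha'⟩ ⟨hb, hb'⟩
    refine ⟨fun x y z => ?_, fun x => ?_⟩
    · simp [hb, ha]
    · simp [hb', ha']
  one_mem' := by simp
  inv_mem' := by
    rintro a ⟨ha, ha'⟩
    refine ⟨fun x y z => ?_, fun x => ?_⟩
    · apply a.injective
      simp [ha]
    · rw [← ha']; simp

/-- Elements acting trivially (linearly) on `W` and modulo `W`. -/
def IsT (W : AddSubgroup Ω) (h : Equiv.Perm Ω) : Prop :=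
  (∀ w ∈ W, h w = w + h 0) ∧ ∀ x, h x + x + h 0 ∈ W

/-- Global hypotheses on the set. -/
structure GG (G : Set Ω) : Prop where
  h2 : ∀ x : Ω, x + x = 0
  zero : (0 : Ω) ∈ G
  sidon : ∀ p ∈ G, ∀ q ∈ G, ∀ r ∈ G, ∀ s ∈ G, p + q + r + s = 0 → p = q ∨ p = r ∨ p = s
  span : ∀ h ∈ HG G, (∀ p ∈ G, h p = p) → h = 1
  card : 16 ≤ G.ncard

/-- `G` is the graph of a quadratic function with respect to `W`. -/
structure QS (G : Set Ω) (W : AddSubgroup Ω) : Prop where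
  tr : ∀ p ∈ G, ∀ q ∈ G, ∃ t ∈ HG G, IsT W t ∧ t p = q
  ex : ∀ x, ∃ p ∈ G, x + p ∈ W
  un : ∀ p ∈ G, ∀ q ∈ G, p + q ∈ W → p = q

theorem IsT.mul (h2 : ∀ x : Ω, x + x = 0) {G : Set Ω} {W : AddSubgroup Ω} {a b : Equiv.Perm Ω}
    (ha : a ∈ HG G)
    (hA : IsT W a) (hB : IsT W b) : IsT W (a * b) := by
  refine ⟨fun w hw => ?_, fun x => ?_⟩
  · have h1 := hB.1 w hw
    have h3 := ha.1 w (b 0) 0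
    have h4 := hA.1 w hw
    have h5 := h2 (a 0)
    simp only [Equiv.Perm.mul_apply]
    rw [h1]
    grind
  · have h1 := hB.2 x
    have h3 := hA.2 (b x)
    have h4 := hA.2 (b 0)
    have := add_mem h1 (add_mem h3 h4)
    simp only [Equiv.Perm.mul_apply]
    have h5 := h2 (a 0)
    have h6 := h2 (b 0)
    have h7 := h2 (b x)
    have : a (b x) + x + a (b 0) = b x + x + b 0 + (a (b x) + b x + a 0 + (a (b 0) + b 0 + a 0)) := by
      grind
    rwa [this]

theorem IsT.inv (h2 : ∀ x : Ω, x + x = 0) {G : Set Ω} {W : AddSubgroup Ω} {a : Equiv.Perm Ω}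
    (ha : a ∈ HG G) (hA : IsT W a) : IsT W a⁻¹ := by
  refine ⟨fun w hw => ?_, fun x => ?_⟩
  · apply a.injective
    have h1 := hA.1 w hw
    have h3 := ha.1 w (a⁻¹ 0) 0
    have h5 := h2 (a 0)
    have hinv : ∀ x, a (a⁻¹ x) = x := a.apply_symm_apply
    simp only [hinv, add_zero] at *
    grind
  · have h1 := hA.2 (a⁻¹ x)
    have h3 := hA.2 (a⁻¹ 0)
    have hinv : ∀ x, a (a⁻¹ x) = x := a.apply_symm_apply
    simp only [hinv] at *
    have h5 := h2 (a 0)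
    have := add_mem h1 h3
    have e : a⁻¹ x + x + a⁻¹ 0 = x + a⁻¹ x + a 0 + (0 + a⁻¹ 0 + a 0) := by grind
    rwa [e]

/-- The group of elements of type `W`. -/
def TW (h2 : ∀ x : Ω, x + x = 0) (G : Set Ω) (W : AddSubgroup Ω) : Subgroup (HG G) where
  carrier := {h | IsT W h.1}
  mul_mem' := fun {a b} ha hb => IsT.mul h2 a.2 ha hb
  one_mem' := ⟨by simp, fun x => by simp [h2]⟩
  inv_mem' := fun {a} ha => IsT.inv h2 a.2 ha

theorem mem_TW (h2 : ∀ x : Ω, x + x = 0) {G : Set Ω} {W : AddSubgroup Ω} {h : HG G} :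
    h ∈ TW h2 G W ↔ IsT W h.1 := Iff.rfl

variable {G : Set Ω} {W : AddSubgroup Ω}

theorem app_mem (t : HG G) {p : Ω} (hp : p ∈ G) : t.1 p ∈ G := (t.2.2 p).2 hp

theorem T_eq_of (hG : GG G) (hW : QS G W) {t s : HG G} (ht : t ∈ TW hG.h2 G W)
    (hs : s ∈ TW hG.h2 G W) {p : Ω} (hp : p ∈ G) (h : t.1 p + s.1 p ∈ W) : t = s := by
  have key : s⁻¹ * t = 1 := by
    apply Subtype.ext
    apply hG.span _ (s⁻¹ * t).2
    intro q hq
    have : t.1 q = s.1 q := by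
      apply hW.un _ (app_mem t hq) _ (app_mem s hq)
      have a1 := ht.2 q
      have a2 := ht.2 p
      have a3 := hs.2 q
      have a4 := hs.2 p
      have := add_mem (add_mem (add_mem a1 a2) (add_mem a3 a4)) h
      have b1 := hG.h2 (t.1 0)
      have b2 := hG.h2 (s.1 0)
      have b3 := hG.h2 (t.1 p)
      have b4 := hG.h2 (s.1 p)
      have b5 := hG.h2 p
      have b6 := hG.h2 q
      have e : t.1 q + s.1 q = t.1 q + q + t.1 0 + (t.1 p + p + t.1 0) +
        (s.1 q + q + s.1 0 + (s.1 p + p + s.1 0)) + (t.1 p + s.1 p) := by grind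
      rwa [e]
    change s.1⁻¹ (t.1 q) = q
    rw [this]; simp
  exact (inv_mul_eq_one.1 key).symm

theorem T_shift (hG : GG G) {t s : HG G} (ht : t ∈ TW hG.h2 G W)
    (x : Ω) : t.1 (s.1 x) + (s.1 x + t.1 0) ∈ W := by
  have a1 := ht.2 (s.1 x)
  rwa [add_assoc] at a1

theorem T_comm (hG : GG G) (hW : QS G W) {t s : HG G} (ht : t ∈ TW hG.h2 G W)
    (hs : s ∈ TW hG.h2 G W) : t * s = s * t := by
  apply T_eq_of hG hW (mul_mem ht hs) (mul_mem hs ht) hG.zero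
  have a1 := ht.2 (s.1 0)
  have a2 := hs.2 (t.1 0)
  have := add_mem a1 a2
  change t.1 (s.1 0) + s.1 (t.1 0) ∈ W
  have b1 := hG.h2 (t.1 0)
  have b2 := hG.h2 (s.1 0)
  have e : t.1 (s.1 0) + s.1 (t.1 0) =
    t.1 (s.1 0) + s.1 0 + t.1 0 + (s.1 (t.1 0) + t.1 0 + s.1 0) := by grind
  rwa [e]

theorem T_sq (hG : GG G) (hW : QS G W) {t : HG G} (ht : t ∈ TW hG.h2 G W) : t * t = 1 := by
  apply T_eq_of hG hW (mul_mem ht ht) (one_mem _) hG.zero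
  have a1 := ht.2 (t.1 0)
  change t.1 (t.1 0) + 0 ∈ W
  have b1 := hG.h2 (t.1 0)
  have e : t.1 (t.1 0) + 0 = t.1 (t.1 0) + t.1 0 + t.1 0 := by grind
  rwa [e]

theorem T_fix (hG : GG G) (hW : QS G W) {t : HG G} (ht : t ∈ TW hG.h2 G W) (h1 : t ≠ 1)
    {x : Ω} (hx : x ∉ W) (hf : t.1 x = x + t.1 0) : x + t.1 0 ∈ W := by
  obtain ⟨p, hp, hxp⟩ := hW.ex x
  have a1 := t.2.1 x (x + p) 0
  have a2 := ht.1 _ hxp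
  have b1 := hG.h2 x
  have b2 := hG.h2 (t.1 0)
  have b3 := hG.h2 p
  have e : x + (x + p) + 0 = p := by grind
  rw [e] at a1
  have e2 : 0 + p + t.1 0 + t.1 p = 0 := by grind
  rcases hG.sidon 0 hG.zero p hp _ (app_mem t hG.zero) _ (app_mem t hp) e2 with h | h | h
  · subst h; simp at hxp; exact absurd hxp hx
  · exfalso; apply h1
    apply T_eq_of hG hW ht (one_mem _) hG.zero
    rw [← h]; simp
  · have : x + t.1 0 = x + p := by grind
    rwa [this]

theorem T_selfcent (hG : GG G) (hW : QS G W) {s : HG G}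
    (hs : ∀ t ∈ TW hG.h2 G W, t * s = s * t) : s ∈ TW hG.h2 G W := by
  obtain ⟨t, htG, ht, h0⟩ := hW.tr 0 hG.zero (s.1 0) (app_mem s hG.zero)
  have key : (⟨t, htG⟩ : HG G)⁻¹ * s = 1 := by
    apply Subtype.ext
    apply hG.span _ (_ : HG G).2
    intro q hq
    obtain ⟨r, hrG, hr, h0'⟩ := hW.tr 0 hG.zero q hq
    have c1 := hs ⟨r, hrG⟩ hr
    have c2 : (⟨t, htG⟩ : HG G) * ⟨r, hrG⟩ = ⟨r, hrG⟩ * ⟨t, htG⟩ := T_comm hG hW ht hr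
    have c1' : r (s.1 0) = s.1 (r 0) := congrArg (fun z : HG G => z.1 0) c1
    have c2' : t (r 0) = r (t 0) := congrArg (fun z : HG G => z.1 0) c2
    change t⁻¹ (s.1 q) = q
    rw [← h0', ← c1', ← h0, ← c2']; simp
  rw [← inv_mul_eq_one.1 key]
  exact ht

theorem T_ncard [Finite Ω] (hG : GG G) (hW : QS G W) : 16 ≤ (TW hG.h2 G W : Set (HG G)).ncard := by
  refine hG.card.trans ?_
  have : G = (fun t : HG G => t.1 0) '' (TW hG.h2 G W : Set (HG G)) := by
    ext q
    constructor
    · intro hq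
      obtain ⟨r, hrG, hr, h0'⟩ := hW.tr 0 hG.zero q hq
      exact ⟨⟨r, hrG⟩, hr, h0'⟩
    · rintro ⟨t, -, rfl⟩
      exact app_mem t hG.zero
  have h3 := congrArg Set.ncard this
  rw [h3]
  exact Set.ncard_image_le (Set.toFinite _)

theorem T_move (hG : GG G) {t : HG G} (ht : t ∈ TW hG.h2 G W) {y z : Ω} (h : y + z ∈ W) :
    t.1 y + y = t.1 z + z := by
  have a1 := t.2.1 z (y + z) 0
  have a2 := ht.1 _ h
  have b1 := hG.h2 z
  have b2 := hG.h2 (t.1 0)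
  have b3 := hG.h2 y
  have e : z + (y + z) + 0 = y := by grind
  rw [e] at a1
  grind

theorem T_bil (hG : GG G) {t : HG G} (ht : t ∈ TW hG.h2 G W) {x y z : Ω}
    (h : y + (z + x) ∈ W) :
    t.1 y + y = t.1 z + z + t.1 x + x + t.1 0 := by
  have a1 := T_move hG ht h
  have a2 := t.2.1 z x 0
  have b2 := hG.h2 (t.1 0)
  simp only [add_zero] at a2
  grind


theorem QS.eq_of_le (hG : GG G) {W' : AddSubgroup Ω} (hW : QS G W) (hW' : QS G W')
    (h : W ≤ W') : W = W' := by
  refine le_antisymm h fun x hx => ?_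
  obtain ⟨p, hp, hxp⟩ := hW.ex x
  have h1 := h hxp
  have h3 : p ∈ W' := (add_mem_cancel_left hx).1 h1
  have h4 : p = 0 := hW'.un p hp 0 hG.zero (by simpa using h3)
  subst h4
  simpa using hxp

set_option maxHeartbeats 1000000 in
theorem core_count [Finite Ω] (hG : GG G) {W' : AddSubgroup Ω} (hW : QS G W) (hW' : QS G W')
    (hn : ∀ t ∈ TW hG.h2 G W, ∀ s ∈ TW hG.h2 G W', s * t * s⁻¹ ∈ TW hG.h2 G W)
    (hn' : ∀ t ∈ TW hG.h2 G W, ∀ s ∈ TW hG.h2 G W', t * s * t⁻¹ ∈ TW hG.h2 G W') : W = W' := by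
  by_contra hne
  have hnle : ¬ W ≤ W' := fun h => hne (hW.eq_of_le hG hW' h)
  have hnle' : ¬ W' ≤ W := fun h => hne (hW'.eq_of_le hG hW h).symm
  obtain ⟨w, hw, hww⟩ := SetLike.not_le_iff_exists.1 hnle
  obtain ⟨w', hw', hww'⟩ := SetLike.not_le_iff_exists.1 hnle'
  have hD : ∀ d ∈ TW hG.h2 G W, d ∈ TW hG.h2 G W' → d ≠ 1 → w' + d.1 0 ∈ W :=
    fun d hd hd' h1 => T_fix hG hW hd h1 hww' (hd'.1 _ hw')
  have hDu : ∀ d ∈ TW hG.h2 G W, d ∈ TW hG.h2 G W' → d ≠ 1 →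
      ∀ e ∈ TW hG.h2 G W, e ∈ TW hG.h2 G W' → e ≠ 1 → d = e := by
    intro d hd hd' h1 e he he' h1'
    apply T_eq_of hG hW hd he hG.zero
    have a := add_mem (hD d hd hd' h1) (hD e he he' h1')
    have b := hG.h2 w'
    have : d.1 0 + e.1 0 = w' + d.1 0 + (w' + e.1 0) := by clear * - b; grind
    rwa [this]
  -- an element of `T'` outside `T`
  have hex : ∃ s ∈ TW hG.h2 G W', s ∉ TW hG.h2 G W := by
    by_contra hcon
    push Not at hcon
    have h16 := T_ncard hG hW'
    have h1 : ∃ e ∈ TW hG.h2 G W', e ≠ 1 := by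
      by_contra hc
      push Not at hc
      have : (TW hG.h2 G W' : Set (HG G)) ⊆ {1} := fun x hx => by simpa using hc x hx
      have := Set.ncard_le_ncard this (Set.toFinite _)
      rw [Set.ncard_singleton] at this
      omega
    obtain ⟨e, he, he1⟩ := h1
    have : (TW hG.h2 G W' : Set (HG G)) ⊆ {1, e} := by
      intro x hx
      by_cases hx1 : x = 1
      · simp [hx1]
      · simp [hDu x (hcon x hx) hx hx1 e (hcon e he) he he1]
    have := Set.ncard_le_ncard this (Set.toFinite _)
    have h3 := Set.ncard_insert_le (1 : HG G) {e}
    rw [Set.ncard_singleton] at h3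
    omega
  obtain ⟨s, hs, hsT⟩ := hex
  have hncent : ∃ b ∈ TW hG.h2 G W, b * s ≠ s * b := by
    by_contra hc
    push Not at hc
    exact hsT (T_selfcent hG hW hc)
  obtain ⟨b, hb, hbs⟩ := hncent
  have hcomm : ∀ t ∈ TW hG.h2 G W, s * t * s⁻¹ * t⁻¹ ∈ TW hG.h2 G W ∧
      s * t * s⁻¹ * t⁻¹ ∈ TW hG.h2 G W' := by
    intro t ht
    refine ⟨mul_mem (hn t ht s hs) (inv_mem ht), ?_⟩
    have := mul_mem hs (hn' t ht _ (inv_mem hs))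
    simpa [mul_assoc] using this
  have hc1 : ∀ t, s * t * s⁻¹ * t⁻¹ = 1 → s * t = t * s := by
    intro t ht
    exact (mul_inv_eq_iff_eq_mul.1 (mul_inv_eq_one.1 ht))
  obtain ⟨d, hd⟩ : ∃ d, d = s * b * s⁻¹ * b⁻¹ := ⟨_, rfl⟩
  have hdT : d ∈ TW hG.h2 G W := hd ▸ (hcomm b hb).1
  have hdT' : d ∈ TW hG.h2 G W' := hd ▸ (hcomm b hb).2
  have hd1 : d ≠ 1 := by
    intro h
    exact hbs (hc1 b (hd ▸ h)).symm
  have hsb : s * b = d * b * s := by rw [hd]; group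
  have hdich : ∀ t ∈ TW hG.h2 G W, s * t = t * s ∨ s * (t * b) = (t * b) * s := by
    intro t ht
    by_cases h1 : s * t * s⁻¹ * t⁻¹ = 1
    · exact Or.inl (hc1 t h1)
    · right
      have h3 := hDu _ (hcomm t ht).1 (hcomm t ht).2 h1 d hdT hdT' hd1
      have h4 : s * t = d * t * s := by rw [← h3]; group
      calc s * (t * b) = (s * t) * b := by group
        _ = d * t * (s * b) := by rw [h4]; group
        _ = (d * t * d) * b * s := by rw [hsb]; group
        _ = (t * b) * s := by
          rw [T_comm hG hW hdT ht, mul_assoc t d d, T_sq hG hW hdT, mul_one]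
  -- the key computation
  have hkey : ∀ x ∈ TW hG.h2 G W, s * x = x * s →
      d.1 (x.1 0) + x.1 0 + d.1 0 = 0 ∨ d.1 (x.1 0) + x.1 0 + d.1 0 = s.1 w + w + s.1 0 := by
    intro x hx hxs
    obtain ⟨v, hv⟩ : ∃ v, v = b.1 (x.1 0) + x.1 0 + b.1 0 := ⟨_, rfl⟩
    have hvW : v ∈ W := hv ▸ hb.2 (x.1 0)
    have e1 : s.1 (b.1 (x.1 0)) = d.1 (b.1 (x.1 (s.1 0))) := by
      have : s * b * x = d * b * x * s := by rw [hsb, mul_assoc (d * b), hxs]; group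
      exact congrArg (fun z : HG G => z.1 0) this
    have e2 : s.1 (x.1 0) = x.1 (s.1 0) := congrArg (fun z : HG G => z.1 0) hxs
    have e3 : s.1 (b.1 0) = d.1 (b.1 (s.1 0)) := congrArg (fun z : HG G => z.1 0) hsb
    have e4 : s.1 v = s.1 (b.1 (x.1 0)) + s.1 (x.1 0) + s.1 (b.1 0) := by rw [hv, s.2.1]
    have f1 : d.1 (b.1 (x.1 (s.1 0))) + x.1 (s.1 0) =
        d.1 (b.1 (s.1 0)) + s.1 0 + d.1 (b.1 (x.1 0)) + x.1 0 + d.1 (b.1 0) := by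
      refine T_bil hG (mul_mem hdT hb) ?_
      rw [← add_assoc]
      exact hx.2 (s.1 0)
    have f2 : d.1 (b.1 (x.1 0)) + b.1 (x.1 0) =
        d.1 (b.1 0) + b.1 0 + d.1 (x.1 0) + x.1 0 + d.1 0 := by
      refine T_bil hG hdT ?_
      have := hb.2 (x.1 0)
      have e : b.1 (x.1 0) + (b.1 0 + x.1 0) = b.1 (x.1 0) + x.1 0 + b.1 0 := by abel
      rwa [e]
    have hfin : d.1 (x.1 0) + x.1 0 + d.1 0 = s.1 v + v + s.1 0 := by
      have g1 := hG.h2 (d.1 (b.1 (s.1 0)))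
      have g2 := hG.h2 (s.1 0)
      have g3 := hG.h2 (x.1 0)
      have g4 := hG.h2 (b.1 0)
      have g5 := hG.h2 (d.1 (b.1 0))
      rw [e4, e1, e2, e3, hv]
      linear_combination (norm := module) -f1 - f2 - g1 - g2 - g3 - g4 - g5
    rw [hfin]
    by_cases hvW' : v ∈ W'
    · left
      have := hs.1 v hvW'
      have g1 := hG.h2 v
      have g2 := hG.h2 (s.1 0)
      clear * - this g1 g2
      grind
    · right
      have k1 := T_fix hG hW' hdT' hd1 hvW' (hdT.1 v hvW)
      have k2 := T_fix hG hW' hdT' hd1 hww (hdT.1 w hw)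
      have k3 : v + w ∈ W' := by
        have := add_mem k1 k2
        have g := hG.h2 (d.1 0)
        have e : v + w = v + d.1 0 + (w + d.1 0) := by clear * - g; grind
        rwa [e]
      have := T_move hG hs k3
      rw [this]
  have hfib : ∀ x ∈ TW hG.h2 G W, ∀ y ∈ TW hG.h2 G W,
      d.1 (x.1 0) + x.1 0 + d.1 0 = d.1 (y.1 0) + y.1 0 + d.1 0 → x = y ∨ x = y * d := by
    intro x hx y hy hxy
    by_cases hu : x.1 0 + y.1 0 ∈ W
    · exact Or.inl (T_eq_of hG hW hx hy hG.zero hu)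
    · right
      have a1 := d.2.1 (x.1 0) (y.1 0) 0
      have g1 := hG.h2 (x.1 0)
      have g2 := hG.h2 (y.1 0)
      have g3 := hG.h2 (d.1 0)
      have g4 := hG.h2 (d.1 (y.1 0))
      have g5 := hG.h2 (d.1 (x.1 0))
      have a2 : d.1 (x.1 0 + y.1 0) = x.1 0 + y.1 0 + d.1 0 := by
        rw [add_zero] at a1
        rw [a1]
        clear * - hxy g1 g2 g3 g4 g5
        grind
      have a3 := T_fix hG hW hdT hd1 hu a2
      apply T_eq_of hG hW hx (mul_mem hy hdT) hG.zero
      have a4 := hy.2 (d.1 0)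
      have a5 := add_mem a3 a4
      change x.1 0 + y.1 (d.1 0) ∈ W
      have e : x.1 0 + y.1 (d.1 0) = x.1 0 + y.1 0 + d.1 0 + (y.1 (d.1 0) + d.1 0 + y.1 0) := by
        clear * - g1 g2 g3
        grind
      rwa [e]
  have hC : ∃ x1 : HG G, ∀ x ∈ TW hG.h2 G W, s * x = x * s →
      x = 1 ∨ x = d ∨ x = x1 ∨ x = x1 * d := by
    have h0 : ∀ x ∈ TW hG.h2 G W, d.1 (x.1 0) + x.1 0 + d.1 0 = 0 → x = 1 ∨ x = d := by
      intro x hx h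
      have := hfib x hx 1 (one_mem _) (by rw [h]; simp [hG.h2])
      simpa using this
    by_cases hx1 : ∃ x1 ∈ TW hG.h2 G W,
        d.1 (x1.1 0) + x1.1 0 + d.1 0 = s.1 w + w + s.1 0
    · obtain ⟨x1, hx1, h1⟩ := hx1
      refine ⟨x1, fun x hx hxs => ?_⟩
      rcases hkey x hx hxs with h | h
      · rcases h0 x hx h with h | h <;> simp [h]
      · rcases hfib x hx x1 hx1 (h.trans h1.symm) with h | h <;> simp [h]
    · refine ⟨1, fun x hx hxs => ?_⟩
      rcases hkey x hx hxs with h | h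
      · rcases h0 x hx h with h | h <;> simp [h]
      · exact absurd ⟨x, hx, h⟩ hx1
  obtain ⟨x1, hC⟩ := hC
  classical
  have hsub : (TW hG.h2 G W : Set (HG G)) ⊆
      (({1, d, x1, x1 * d, b⁻¹, d * b⁻¹, x1 * b⁻¹, x1 * d * b⁻¹} : Finset (HG G)) : Set (HG G)) := by
    intro t ht
    rcases hdich t ht with h | h
    · rcases hC t ht h with h | h | h | h <;>
        simp only [Finset.coe_insert, Finset.coe_singleton, Set.mem_insert_iff,
          Set.mem_singleton_iff, h, true_or, or_true]
    · rcases hC (t * b) (mul_mem ht hb) h with h | h | h | h <;>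
        rw [← eq_mul_inv_iff_mul_eq] at h <;>
        simp only [Finset.coe_insert, Finset.coe_singleton, Set.mem_insert_iff,
          Set.mem_singleton_iff, h, one_mul, true_or, or_true]
  have h8 := Set.ncard_le_ncard hsub (Set.toFinite _)
  rw [Set.ncard_coe_finset] at h8
  have h9 : ({1, d, x1, x1 * d, b⁻¹, d * b⁻¹, x1 * b⁻¹, x1 * d * b⁻¹} : Finset (HG G)).card ≤ 8 :=
    (Finset.card_insert_le _ _).trans <| Nat.succ_le_succ <|
      (Finset.card_insert_le _ _).trans <| Nat.succ_le_succ Finset.card_le_six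
  have := T_ncard hG hW
  omega

end Yoshiara
end TPZ

namespace TPZ

section Yoshiara2

variable {Ω : Type*} [AddCommGroup Ω] {G G' : Set Ω} {W W' : AddSubgroup Ω}

theorem perm_inv_apply (φ : Equiv.Perm Ω) (x : Ω) : φ⁻¹ (φ x) = x := φ.symm_apply_apply x

theorem IsT.conj (h2 : ∀ x : Ω, x + x = 0) {φ t : Equiv.Perm Ω}
    (hφ : ∀ x y z, φ (x + y + z) = φ x + φ y + φ z)
    (ht : ∀ x y z, t (x + y + z) = t x + t y + t z)
    (hW : ∀ w, w ∈ W ↔ φ w + φ 0 ∈ W') (hT : IsT W t) : IsT W' (φ * t * φ⁻¹) := by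
  obtain ⟨u, hu⟩ : ∃ u, φ u = 0 := φ.surjective 0
  have hu' : φ⁻¹ 0 = u := by rw [← hu]; simp
  refine ⟨fun w' hw' => ?_, fun x => ?_⟩
  · obtain ⟨w, hw⟩ := φ.surjective (w' + φ 0)
    have hwW : w ∈ W := by
      rw [hW, hw, add_assoc, h2]; simpa using hw'
    have e1 : φ⁻¹ w' = w + 0 + u := by
      apply φ.injective
      rw [hφ, hw, hu]
      change φ (φ⁻¹ w') = _
      have := h2 (φ 0)
      rw [show φ (φ⁻¹ w') = w' from φ.apply_symm_apply w', add_assoc w', this]; simp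
    simp only [Equiv.Perm.mul_apply, hu', e1, ht, hT.1 w hwW]
    have e2 : w + t 0 + t 0 + t u = w + t u + 0 := by rw [add_assoc w, h2]; abel
    rw [e2, hφ, hw]
    have := h2 (φ 0)
    linear_combination (norm := module) this
  · obtain ⟨y, rfl⟩ := φ.surjective x
    have a1 := hT.2 y
    have a2 := hT.2 u
    have a3 := (hW _).1 (add_mem a1 a2)
    simp only [Equiv.Perm.mul_apply, hu', perm_inv_apply]
    have e : t y + y + t 0 + (t u + u + t 0) = t y + y + (t u + u + 0) := by
      have := h2 (t 0)
      linear_combination (norm := module) this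
    rw [e, hφ, hφ, hu] at a3
    have e3 : φ (t y) + φ y + (φ (t u) + 0 + φ 0) + φ 0 = φ (t y) + φ y + φ (t u) := by
      have := h2 (φ 0)
      linear_combination (norm := module) this
    rwa [e3] at a3

theorem QS.transport (h2 : ∀ x : Ω, x + x = 0) {φ : Equiv.Perm Ω}
    (hφ : ∀ x y z, φ (x + y + z) = φ x + φ y + φ z)
    (hGG : ∀ x, φ x ∈ G' ↔ x ∈ G)
    (hW : ∀ w, w ∈ W ↔ φ w + φ 0 ∈ W') (hQ : QS G W) : QS G' W' := by
  have hinv : ∀ x, φ (φ⁻¹ x) = x := φ.apply_symm_apply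
  have hsum : ∀ x y, φ (x + y) + φ 0 = φ x + φ y := by
    intro x y
    have := hφ x y 0
    have h3 := h2 (φ 0)
    rw [add_zero] at this
    linear_combination (norm := module) this + h3
  refine ⟨fun p hp q hq => ?_, fun x => ?_, fun p hp q hq h => ?_⟩
  · obtain ⟨p, rfl⟩ := φ.surjective p
    obtain ⟨q, rfl⟩ := φ.surjective q
    obtain ⟨t, ht, hT, htp⟩ := hQ.tr p ((hGG p).1 hp) q ((hGG q).1 hq)
    refine ⟨φ * t * φ⁻¹, ⟨fun x y z => ?_, fun x => ?_⟩, hT.conj h2 hφ ht.1 hW, ?_⟩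
    · obtain ⟨x, rfl⟩ := φ.surjective x
      obtain ⟨y, rfl⟩ := φ.surjective y
      obtain ⟨z, rfl⟩ := φ.surjective z
      rw [← hφ]
      simp only [Equiv.Perm.mul_apply, perm_inv_apply]
      rw [ht.1, hφ]
    · obtain ⟨x, rfl⟩ := φ.surjective x
      simp only [Equiv.Perm.mul_apply, perm_inv_apply, hGG, ht.2]
    · simp only [Equiv.Perm.mul_apply, perm_inv_apply, htp]
  · obtain ⟨x, rfl⟩ := φ.surjective x
    obtain ⟨p, hp, h⟩ := hQ.ex x
    refine ⟨φ p, (hGG p).2 hp, ?_⟩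
    rw [← hsum, ← hW]; exact h
  · obtain ⟨p, rfl⟩ := φ.surjective p
    obtain ⟨q, rfl⟩ := φ.surjective q
    rw [← hsum, ← hW] at h
    rw [hQ.un p ((hGG p).1 hp) q ((hGG q).1 hq) h]

/-- The linear part of an affine map. -/
def lin (φ : Ω → Ω) (h2 : ∀ x : Ω, x + x = 0)
    (hφ : ∀ x y z, φ (x + y + z) = φ x + φ y + φ z) : Ω →+ Ω :=
  AddMonoidHom.mk' (fun x => φ x + φ 0) (by
    intro x y
    have := hφ x y 0
    rw [add_zero] at this
    rw [this]; abel)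

theorem exists_image (h2 : ∀ x : Ω, x + x = 0) {φ : Equiv.Perm Ω}
    (hφ : ∀ x y z, φ (x + y + z) = φ x + φ y + φ z) (W : AddSubgroup Ω) :
    ∃ W' : AddSubgroup Ω, ∀ w, w ∈ W ↔ φ w + φ 0 ∈ W' := by
  refine ⟨W.map (lin φ h2 hφ), fun w => ?_⟩
  constructor
  · intro hw; exact ⟨w, hw, rfl⟩
  · rintro ⟨v, hv, h⟩
    have : φ v + φ 0 = φ w + φ 0 := h
    rw [← φ.injective (add_right_cancel this)]; exact hv

theorem conj_iff (hG : GG G) (φ : HG G) (hW : ∀ w, w ∈ W ↔ φ.1 w + φ.1 0 ∈ W') (t : HG G) :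
    t ∈ TW hG.h2 G W ↔ φ * t * φ⁻¹ ∈ TW hG.h2 G W' := by
  constructor
  · intro ht
    exact IsT.conj hG.h2 φ.2.1 t.2.1 hW ht
  · intro ht
    have := IsT.conj (W := W') (W' := W) hG.h2 (φ := (φ⁻¹).1) (t := (φ * t * φ⁻¹).1)
      (φ⁻¹).2.1 (φ * t * φ⁻¹).2.1 ?_ ht
    · have e : t = φ⁻¹ * (φ * t * φ⁻¹) * (φ⁻¹)⁻¹ := by group
      rw [mem_TW, e]; exact this
    · intro w
      have hinv : ∀ x, φ.1 ((φ⁻¹).1 x) = x := φ.1.apply_symm_apply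
      have h1 := φ.2.1 ((φ⁻¹).1 w) ((φ⁻¹).1 0) 0
      have h3 := hG.h2 (φ.1 0)
      rw [hW, ← add_zero ((φ⁻¹).1 w + (φ⁻¹).1 0), h1, hinv, hinv, add_assoc (w + 0), h3]
      simp

theorem normal_of_pgroup [Finite Ω] (hG : GG G) (hW : QS G W) (S : Subgroup (HG G))
    (hS : IsPGroup 2 S) (hT : TW hG.h2 G W ≤ S) :
    S ≤ Subgroup.normalizer (TW hG.h2 G W : Set (HG G)) := by
  have : Fact (Nat.Prime 2) := ⟨Nat.prime_two⟩
  have : Group.IsNilpotent S := hS.isNilpotent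
  have hnc := Group.normalizerCondition_of_isNilpotent (G := S)
  by_contra hcon
  have hlt : (Subgroup.normalizer (TW hG.h2 G W : Set (HG G))).subgroupOf S < ⊤ := by
    rw [lt_top_iff_ne_top, ne_eq, Subgroup.subgroupOf_eq_top]; exact hcon
  obtain ⟨s, hs, hs'⟩ := SetLike.exists_of_lt (hnc _ hlt)
  apply hs'
  rw [Subgroup.mem_subgroupOf]
  have hN : ∀ h : HG G, h ∈ S → (h ∈ Subgroup.normalizer (TW hG.h2 G W : Set (HG G)) ↔
      s.1 * h * s.1⁻¹ ∈ Subgroup.normalizer (TW hG.h2 G W : Set (HG G))) := by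
    intro h hh
    have := Subgroup.mem_normalizer_iff.1 hs ⟨h, hh⟩
    simpa [Subgroup.mem_subgroupOf] using this
  obtain ⟨W', hW'⟩ := exists_image hG.h2 s.1.2.1 W
  have hQ' : QS G W' := hW.transport hG.h2 s.1.2.1 s.1.2.2 hW'
  have hc := conj_iff hG s.1 hW'
  have hle := Subgroup.le_normalizer (H := TW hG.h2 G W)
  have hconj : ∀ x ∈ TW hG.h2 G W', ∃ t ∈ TW hG.h2 G W, x = s.1 * t * s.1⁻¹ := by
    intro x hx
    have e : x = s.1 * (s.1⁻¹ * x * s.1) * s.1⁻¹ := by group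
    exact ⟨s.1⁻¹ * x * s.1, (hc _).2 (e ▸ hx), e⟩
  have hWW : W = W' := by
    apply core_count hG hW hQ'
    · intro t ht x hx
      obtain ⟨y, hy, rfl⟩ := hconj x hx
      exact (Subgroup.mem_normalizer_iff.1 ((hN y (hT hy)).1 (hle hy)) t).1 ht
    · intro t ht x hx
      obtain ⟨y, hy, rfl⟩ := hconj x hx
      have h1 : s.1⁻¹ * t * s.1 ∈ Subgroup.normalizer (TW hG.h2 G W : Set (HG G)) := by
        rw [hN _ (mul_mem (mul_mem (inv_mem s.2) (hT ht)) s.2)]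
        have e : s.1 * (s.1⁻¹ * t * s.1) * s.1⁻¹ = t := by group
        rw [e]; exact hle ht
      have h3 := (hc _).1 ((Subgroup.mem_normalizer_iff.1 h1 y).1 hy)
      have e : s.1 * (s.1⁻¹ * t * s.1 * y * (s.1⁻¹ * t * s.1)⁻¹) * s.1⁻¹ =
        t * (s.1 * y * s.1⁻¹) * t⁻¹ := by group
      rwa [e] at h3
  rw [Subgroup.mem_normalizer_iff]
  subst hWW
  exact hc

theorem yoshiara [Finite Ω] (hG : GG G) (hW : QS G W) (hW' : QS G W') :
    ∃ h ∈ HG G, ∀ w, w ∈ W ↔ h w + h 0 ∈ W' := by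
  have : Fact (Nat.Prime 2) := ⟨Nat.prime_two⟩
  have hp : ∀ {W : AddSubgroup Ω}, QS G W → IsPGroup 2 (TW hG.h2 G W) := by
    intro W hW g
    refine ⟨1, ?_⟩
    rw [pow_one, pow_two]
    exact Subtype.ext (T_sq hG hW g.2)
  obtain ⟨S, hS⟩ := (hp hW).exists_le_sylow
  obtain ⟨S', hS'⟩ := (hp hW').exists_le_sylow
  obtain ⟨g, hg⟩ := MulAction.exists_smul_eq (HG G) S S'
  obtain ⟨W1, hW1⟩ := exists_image hG.h2 g.2.1 W
  have hQ1 : QS G W1 := hW.transport hG.h2 g.2.1 g.2.2 hW1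
  have hc := conj_iff hG g hW1
  have hT1 : TW hG.h2 G W1 ≤ S' := by
    intro x hx
    have e : x = g * (g⁻¹ * x * g) * g⁻¹ := by group
    have h1 := hS ((hc _).2 (e ▸ hx))
    rw [← hg, e]
    exact Subgroup.smul_mem_pointwise_smul _ (MulAut.conj g) _ h1
  have n1 := normal_of_pgroup hG hQ1 S' S'.isPGroup' hT1
  have n2 := normal_of_pgroup hG hW' S' S'.isPGroup' hS'
  have : W1 = W' := by
    apply core_count hG hQ1 hW'
    · intro t ht s hs
      exact (Subgroup.mem_normalizer_iff.1 (n1 (hS' hs)) t).1 ht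
    · intro t ht s hs
      exact (Subgroup.mem_normalizer_iff.1 (n2 (hT1 ht)) s).1 hs
  subst this
  exact ⟨g.1, g.2, hW1⟩

end Yoshiara2
end TPZ

namespace TPZ

section FieldPart

variable {K : Type*} [Field K] [Algebra (ZMod 2) K]

theorem ind_two {τ1 τ2 : K ≃ₐ[ZMod 2] K} (h : τ1 ≠ τ2) {a b : K}
    (hz : ∀ x, a * τ1 x + b * τ2 x = 0) : a = 0 := by
  by_contra ha
  apply h
  ext x
  have h1 := hz 1
  have h3 := hz x
  simp only [map_one, mul_one] at h1
  have : a * (τ1 x - τ2 x) = 0 := by linear_combination h3 - τ2 x * h1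
  rcases mul_eq_zero.1 this with h | h
  · exact absurd h ha
  · exact sub_eq_zero.1 h

theorem ind_three {τ1 τ2 τ3 : K ≃ₐ[ZMod 2] K} (h : τ1 ≠ τ2) (h' : τ1 ≠ τ3) {a b c : K}
    (hz : ∀ x, a * τ1 x + b * τ2 x + c * τ3 x = 0) : a = 0 := by
  by_contra ha
  apply h'
  ext y
  have : a * (τ1 y - τ3 y) = 0 := by
    apply ind_two h (b := b * (τ2 y - τ3 y))
    intro x
    have h1 := hz x
    have h3 := hz (x * y)
    simp only [map_mul] at h3
    linear_combination h3 - τ3 y * h1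
  rcases mul_eq_zero.1 this with h | h
  · exact absurd h ha
  · exact sub_eq_zero.1 h

variable [Finite K]

noncomputable instance : Fintype (K ≃ₐ[ZMod 2] K) := Fintype.ofFinite _

theorem ind_all {c : (K ≃ₐ[ZMod 2] K) → K} (hz : ∀ x, ∑ g, c g * g x = 0) (g) : c g = 0 := by
  have h := linearIndependent_monoidHom K K
  have hinj : Function.Injective (fun g : K ≃ₐ[ZMod 2] K => (g : K →* K)) := by
    intro a b hab
    ext x
    exact DFunLike.congr_fun hab x
  have h1 := h.comp _ hinj
  rw [Fintype.linearIndependent_iff] at h1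
  apply h1 c
  funext x
  simpa using hz x

theorem rep (M : K →+ K) : ∃ n : (K ≃ₐ[ZMod 2] K) → K, ∀ x, M x = ∑ g, n g * g x := by
  have : Fact (Nat.Prime 2) := ⟨Nat.prime_two⟩
  let v : (K ≃ₐ[ZMod 2] K) → (K →ₗ[ZMod 2] K) := fun g => g.toLinearMap
  have hli : LinearIndependent K v := by
    rw [Fintype.linearIndependent_iff]
    intro c hc g
    apply ind_all (c := c)
    intro x
    have := congrArg (fun L : K →ₗ[ZMod 2] K => L x) hc
    simpa [v] using this
  have hcard : Fintype.card (K ≃ₐ[ZMod 2] K) = Module.finrank K (K →ₗ[ZMod 2] K) := by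
    rw [Module.finrank_linearMap_self, ← IsGalois.card_aut_eq_finrank (ZMod 2) K,
      Nat.card_eq_fintype_card]
  have hspan := hli.span_eq_top_of_card_eq_finrank' hcard
  have hM : M.toZModLinearMap 2 ∈ Submodule.span K (Set.range v) := by rw [hspan]; trivial
  obtain ⟨n, hn⟩ := (Submodule.mem_span_range_iff_exists_fun K).1 hM
  refine ⟨n, fun x => ?_⟩
  have := congrArg (fun L : K →ₗ[ZMod 2] K => L x) hn
  simpa [v] using this.symm

/-- reindexing -/
theorem sum_shift (τ : K ≃ₐ[ZMod 2] K) (n : (K ≃ₐ[ZMod 2] K) → K) (F : (K ≃ₐ[ZMod 2] K) → K) (x : K) :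
    ∑ g, n g * (g (τ x) * F g) = ∑ h, (n (h * τ⁻¹) * F (h * τ⁻¹)) * h x := by
  rw [← Equiv.sum_comp (Equiv.mulRight τ) (fun h => (n (h * τ⁻¹) * F (h * τ⁻¹)) * h x)]
  refine Finset.sum_congr rfl fun g _ => ?_
  simp only [Equiv.coe_mulRight, mul_inv_cancel_right, AlgEquiv.mul_apply]
  ring

theorem coef {σ : K ≃ₐ[ZMod 2] K} (hσ2 : σ * σ ≠ 1) (τ : K ≃ₐ[ZMod 2] K) (S M : K →+ K) {c : K} (hc : c ≠ 0)
    {n : (K ≃ₐ[ZMod 2] K) → K} (hn : ∀ x, M x = ∑ g, n g * g x)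
    (h : ∀ y w, S y * w + S w * y = M (c * (σ (τ y) * τ w + τ y * σ (τ w))))
    (g : K ≃ₐ[ZMod 2] K) (hg1 : g * (σ * τ) ≠ 1) (hg2 : g * τ ≠ 1) : n g = 0 := by
  classical
  obtain ⟨s, hs⟩ := rep S
  have key : ∀ w, s (g * (σ * τ)) * w = n g * g c * (g * τ) w + n (g * σ) * (g * σ) c * (g * σ * σ * τ) w := by
    intro w
    have := ind_all (c := fun h => s h * w + (if h = 1 then S w else 0)
      - n (h * (σ * τ)⁻¹) * ((h * (σ * τ)⁻¹) c * (h * (σ * τ)⁻¹) (τ w))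
      - n (h * τ⁻¹) * ((h * τ⁻¹) c * (h * τ⁻¹) (σ (τ w)))) ?_ (g * (σ * τ))
    · simp only [hg1, if_false, mul_inv_cancel_right] at this
      rw [show g * (σ * τ) * τ⁻¹ = g * σ by group] at this
      simp only [AlgEquiv.mul_apply] at this ⊢
      linear_combination this
    · intro y
      simp only [sub_mul, add_mul, Finset.sum_sub_distrib, Finset.sum_add_distrib]
      have e1 := sum_shift (σ * τ) n (fun g => g c * g (τ w)) y
      have e2 := sum_shift τ n (fun g => g c * g (σ (τ w))) y
      rw [← e1, ← e2]
      have e3 : ∑ x : (K ≃ₐ[ZMod 2] K), s x * w * x y = S y * w := by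
        rw [hs, Finset.sum_mul]
        exact Finset.sum_congr rfl fun _ _ => by ring
      have e4 : ∑ x : (K ≃ₐ[ZMod 2] K), (if x = 1 then S w else 0) * x y = S w * y := by
        rw [Finset.sum_eq_single 1] <;> simp +contextual
      rw [e3, e4, h, hn, sub_sub, ← Finset.sum_add_distrib, sub_eq_zero]
      refine Finset.sum_congr rfl fun g _ => ?_
      simp only [map_mul, map_add, AlgEquiv.mul_apply]
      ring
  have := ind_three (τ1 := g * τ) (τ2 := 1) (τ3 := g * σ * σ * τ) (a := n g * g c)
    (b := - s (g * (σ * τ))) (c := n (g * σ) * (g * σ) c) hg2 ?_ ?_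
  · rcases mul_eq_zero.1 this with h | h
    · exact h
    · exact absurd (by simpa using h) hc
  · intro h
    apply hσ2
    have h3 := mul_right_cancel h
    rw [mul_assoc] at h3
    exact mul_eq_left.1 h3.symm
  · intro x
    have := key x
    rw [AlgEquiv.one_apply]
    linear_combination -this

theorem inj {σ : K ≃ₐ[ZMod 2] K} (hσ2 : σ * σ ≠ 1) (M : K →+ K)
    (h : ∀ y w, M (σ y * w + y * σ w) = 0) (x : K) : M x = 0 := by
  obtain ⟨n, hn⟩ := rep M
  have hz : ∀ g, n g = 0 := by
    intro g
    have key : ∀ w, n g * g w + n (g * σ) * (g * σ * σ) w = 0 := by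
      intro w
      have := ind_all (c := fun h =>
        n (h * σ⁻¹) * ((h * σ⁻¹) w) + n (h * 1⁻¹) * ((h * 1⁻¹) (σ w))) ?_ (g * σ)
      · simpa [AlgEquiv.mul_apply] using this
      · intro y
        simp only [add_mul, Finset.sum_add_distrib]
        have e1 := sum_shift σ n (fun g => g w) y
        have e2 := sum_shift 1 n (fun g => g (σ w)) y
        rw [← e1, ← e2, ← h y w, hn, ← Finset.sum_add_distrib]
        refine Finset.sum_congr rfl fun g _ => ?_
        simp only [map_mul, map_add, AlgEquiv.one_apply]
        ring
    refine ind_two ?_ key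
    intro h
    apply hσ2
    rw [mul_assoc] at h
    exact mul_eq_left.1 h.symm
  rw [hn]
  simp [hz]

end FieldPart
end TPZ

namespace TPZ

section Deriv

variable {K : Type*} [Field K] [Algebra (ZMod 2) K]

/-- first coordinate of the polarisation of the Taniguchi function -/
def b1 (σ : K ≃ₐ[ZMod 2] K) (α β x y z w : K) : K :=
  σ (σ (σ x)) * σ (σ z) + σ (σ x) * σ (σ (σ z)) + α * (σ (σ x) * σ w + σ (σ z) * σ y)
    + β * (σ y * w + y * σ w)

theorem two0 : (2 : K) = 0 := by
  have := congrArg (algebraMap (ZMod 2) K) (show (2 : ZMod 2) = 0 from rfl)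
  rwa [map_ofNat, map_zero] at this

variable [Finite K]

theorem sq_surj (x : K) : ∃ y : K, y * y = x := by
  have : CharP K 2 := by
    have : Fact (Nat.Prime 2) := ⟨Nat.prime_two⟩
    exact charP_of_injective_algebraMap (algebraMap (ZMod 2) K).injective 2
  have hs : Function.Surjective (fun y : K => y * y) := by
    apply Finite.surjective_of_injective
    intro a b h
    have h' : a * a = b * b := h
    have : (a - b) * (a - b) = 0 := by
      linear_combination h' + (b * b - a * b) * two0 (K := K)
    exact sub_eq_zero.1 (mul_self_eq_zero.1 this)
  exact hs x

theorem M21_zero {σ : K ≃ₐ[ZMod 2] K} (hσ2 : σ * σ ≠ 1) (hσ3 : σ * σ * σ ≠ 1) {β : K}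
    (hβ : β ≠ 0) (Q R M : K →+ K)
    (hR : ∀ x z, R x * z + R z * x = M (σ (σ (σ x)) * σ (σ z) + σ (σ x) * σ (σ (σ z))))
    (hQ : ∀ y w, Q y * w + Q w * y = M (β * (σ y * w + y * σ w))) (x : K) : M x = 0 := by
  obtain ⟨n, hn⟩ := rep M
  have hσ1 : σ ≠ 1 := by rintro rfl; simp at hσ2
  have hz : ∀ g, n g = 0 := by
    intro g
    by_contra hng
    have d1 : g * (σ * (σ * σ)) = 1 ∨ g * (σ * σ) = 1 := by
      by_contra h; push Not at h; exact hng (coef hσ2 (σ * σ) R M one_ne_zero hn (by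
        intro y w; rw [hR, one_mul]; rfl) g h.1 h.2)
    have d2 : g * (σ * 1) = 1 ∨ g * 1 = 1 := by
      by_contra h; push Not at h; exact hng (coef hσ2 1 Q M hβ hn (by intro y w; rw [hQ]; rfl) g h.1 h.2)
    rw [mul_one, mul_one] at d2
    rcases d2 with h | h
    · rw [← mul_assoc g, h, one_mul] at d1
      rw [← mul_assoc g, h, one_mul] at d1
      tauto
    · rw [h, one_mul, one_mul, ← mul_assoc] at d1
      tauto
  rw [hn]; simp [hz]

theorem cross {P S M : K →+ K} (h : ∀ x w, P x * w + x * S w = M (x * w)) :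
    (∀ x, P x = P 1 * x) ∧ ∀ x, S x = S 1 * x := by
  have h2 := two0 (K := K)
  have hD : ∀ t, M t + (S 1 + P 1) * t = 0 := by
    intro t
    obtain ⟨y, rfl⟩ := sq_surj t
    have e1 := h y y
    have e2 := h y 1
    have e3 := h 1 y
    simp only [mul_one, one_mul] at e2 e3
    linear_combination -e1 + y * e2 + y * e3 + y * M y * h2
  constructor
  · intro x
    have e1 := h x 1
    have e2 := hD x
    simp only [mul_one] at e1
    linear_combination e1 + e2 - (S 1 + P 1) * x * h2
  · intro x
    have e1 := h 1 x
    have e2 := hD x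
    simp only [one_mul] at e1
    linear_combination e1 + e2 - (S 1 + P 1) * x * h2

theorem deriv_trivial {σ : K ≃ₐ[ZMod 2] K} (hσ2 : σ * σ ≠ 1) (hσ3 : σ * σ * σ ≠ 1) {α β : K}
    (hα : α ≠ 0) (hβ : β ≠ 0) (P Q R S M11 M12 M21 M22 : K →+ K)
    (H1 : ∀ x y z w, b1 σ α β (P x + Q y) (R x + S y) z w + b1 σ α β x y (P z + Q w) (R z + S w)
      = M11 (b1 σ α β x y z w) + M12 (x * w + y * z))
    (H2 : ∀ x y z w, (P x + Q y) * w + (R x + S y) * z + (x * (R z + S w) + y * (P z + Q w))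
      = M21 (b1 σ α β x y z w) + M22 (x * w + y * z)) :
    ∃ p, (∀ x, P x = p * x) ∧ (∀ x, Q x = 0) ∧ (∀ x, R x = 0) ∧ (∀ x, S x = σ (σ p) * x) := by
  have h2 := two0 (K := K)
  have hσ1 : σ ≠ 1 := by rintro rfl; simp at hσ2
  have hM21 : ∀ x, M21 x = 0 := by
    refine M21_zero hσ2 hσ3 hβ Q R M21 ?_ ?_
    · intro x z
      have := H2 x 0 z 0
      simp only [b1, map_zero, mul_zero, zero_mul, add_zero, zero_add] at this
      rw [← this]; ring
    · intro y w
      have := H2 0 y 0 w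
      simp only [b1, map_zero, mul_zero, zero_mul, add_zero, zero_add] at this
      rw [← this]; ring
  have hR : ∀ x, R x = R 1 * x := by
    intro x
    have := H2 x 0 1 0
    simp only [hM21, map_zero, mul_zero, zero_mul, add_zero, zero_add, mul_one] at this
    linear_combination this - x * R 1 * h2
  have hQ : ∀ x, Q x = Q 1 * x := by
    intro x
    have := H2 0 x 0 1
    simp only [hM21, map_zero, mul_zero, zero_mul, add_zero, zero_add, mul_one] at this
    linear_combination this - x * Q 1 * h2
  obtain ⟨hP, hS⟩ := cross (P := P) (S := S) (M := M22) (by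
    intro x w
    have := H2 x 0 0 w
    simpa [hM21] using this)
  generalize P 1 = p at *
  generalize Q 1 = q at *
  generalize R 1 = r at *
  generalize S 1 = s at *
  let L : (K ≃ₐ[ZMod 2] K) → K → K →+ K := fun τ a =>
    (AddMonoidHom.mulLeft a).comp (τ : K ≃ₐ[ZMod 2] K).toRingEquiv.toAddMonoidHom
  have hL : ∀ τ a t, L τ a t = a * τ t := fun _ _ _ => rfl
  have hI1 : ∀ t, M11 (σ (σ t)) + (σ (σ (σ p)) + σ (σ p)) * σ (σ t) + α * σ r * σ t = 0 := by
    intro t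
    have := inj hσ2 (M11.comp (σ * σ : K ≃ₐ[ZMod 2] K).toRingEquiv.toAddMonoidHom
      + L (σ * σ) (σ (σ (σ p)) + σ (σ p)) + L σ (α * σ r)) (by
        intro x z
        have := H1 x 0 z 0
        simp only [b1, hP, hR, map_zero, mul_zero, zero_mul, add_zero, zero_add] at this
        change M11 (σ (σ (σ x * z + x * σ z))) + (σ (σ (σ p)) + σ (σ p)) * σ (σ (σ x * z + x * σ z))
          + α * σ r * σ (σ x * z + x * σ z) = 0
        simp only [map_add, map_mul] at this ⊢
        linear_combination -this + ((σ (σ (σ p)) + σ (σ p)) * (σ (σ (σ x)) * σ (σ z) + σ (σ x) * σ (σ (σ z))) + α * σ r * (σ (σ x) * σ z + σ x * σ (σ z))) * h2) t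
    exact this
  have hI2 : ∀ t, M11 (β * t) + α * σ (σ q) * σ t + β * (s + σ s) * t = 0 := by
    intro t
    have := inj hσ2 (M11.comp (AddMonoidHom.mulLeft β)
      + L σ (α * σ (σ q)) + L 1 (β * (s + σ s))) (by
        intro x z
        have := H1 0 x 0 z
        simp only [b1, hQ, hS, map_zero, mul_zero, zero_mul, add_zero, zero_add] at this
        change M11 (β * (σ x * z + x * σ z)) + α * σ (σ q) * σ (σ x * z + x * σ z)
          + β * (s + σ s) * (σ x * z + x * σ z) = 0
        simp only [map_add, map_mul] at this ⊢
        linear_combination -this + (α * σ (σ q) * (σ (σ x) * σ z + σ x * σ (σ z)) + β * (s + σ s) * (σ x * z + x * σ z)) * h2) t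
    exact this
  set c := σ (σ (σ p)) + σ (σ p) with hc
  have hM11 : ∀ t, M11 t + c * t + α * σ r * σ⁻¹ t = 0 := by
    intro t
    obtain ⟨u, rfl⟩ := (σ * σ).surjective t
    have := hI1 u
    rw [show σ⁻¹ ((σ * σ) u) = σ u from σ.symm_apply_apply _]
    exact this
  have hcomb : ∀ t, α * σ (σ q) * σ t + β * (s + σ s + c) * (1 : K ≃ₐ[ZMod 2] K) t
      + α * σ r * σ⁻¹ β * σ⁻¹ t = 0 := by
    intro t
    have e1 := hI2 t
    have e2 := hM11 (β * t)
    simp only [map_mul] at e2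
    rw [AlgEquiv.one_apply]
    linear_combination e1 + e2 - M11 (β * t) * h2
  have hσi : σ ≠ σ⁻¹ := by
    intro h; apply hσ2; nth_rewrite 2 [h]; simp
  have hσi1 : σ⁻¹ ≠ 1 := by simpa using hσ1
  have hq : q = 0 := by
    have := ind_three hσ1 hσi hcomb
    simpa [hα] using this
  have hcs : s + σ s + c = 0 := by
    have := ind_three (τ1 := 1) (τ2 := σ) (τ3 := σ⁻¹) hσ1.symm hσi1.symm
      (a := β * (s + σ s + c)) (b := α * σ (σ q)) (c := α * σ r * σ⁻¹ β) (by
        intro x; rw [← hcomb x]; ring)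
    simpa [hβ] using this
  have hr : r = 0 := by
    have := ind_three (τ1 := σ⁻¹) (τ2 := σ) (τ3 := 1) hσi.symm hσi1
      (c := β * (s + σ s + c)) (b := α * σ (σ q)) (a := α * σ r * σ⁻¹ β) (by
        intro x; rw [← hcomb x]; ring)
    simpa [hα, hβ] using this
  subst hq hr
  have hM12 : ∀ x w, M12 (x * w) = α * (σ (σ p) + σ s + c) * (σ (σ x) * σ w) := by
    intro x w
    have e1 := H1 x 0 0 w
    have e2 := hM11 (α * (σ (σ x) * σ w))
    simp only [b1, hP, hS, hQ, hR, map_zero, mul_zero, zero_mul, add_zero, zero_add, map_mul] at e1 e2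
    linear_combination -e1 - e2
  have hκ : α * (σ (σ p) + σ s + c) = 0 := by
    apply ind_two (τ1 := σ * σ) (τ2 := σ) (b := α * (σ (σ p) + σ s + c))
    · intro t
      have e1 := hM12 t 1
      have e2 := hM12 1 t
      simp only [map_one, mul_one, one_mul] at e1 e2
      rw [AlgEquiv.mul_apply]
      linear_combination -e1 - e2 + M12 t * h2
    · intro h; exact hσ1 (mul_eq_left.1 h)
  have hfin : s = σ (σ p) := by
    have e : σ (σ p) + σ s + c = 0 := by simpa [hα] using hκ
    linear_combination hcs - e - σ (σ p) * h2 + σ (σ p) * h2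
  exact ⟨p, hP, by simpa using hQ, by simpa using hR, by rw [← hfin]; exact hS⟩

end Deriv
end TPZ

namespace TPZ

section Graph

variable {V : Type*} [AddCommGroup V]

/-- `q` is quadratic with polarisation `B`. -/
structure Quad (q : V → V) (B : V → V → V) : Prop where
  h2 : ∀ x : V, x + x = 0
  q0 : q 0 = 0
  pol : ∀ x y, q (x + y) = q x + q y + B x y
  add : ∀ x y z, B (x + y) z = B x z + B y z

namespace Quad

variable {q : V → V} {B : V → V → V}

theorem symm (h : Quad q B) (x y : V) : B x y = B y x := by
  have h1 := h.pol x y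
  have h3 := h.pol y x
  rw [add_comm y x, h1] at h3
  linear_combination (norm := module) h3

theorem add' (h : Quad q B) (x y z : V) : B z (x + y) = B z x + B z y := by
  rw [h.symm, h.add, h.symm x, h.symm y]

theorem self (h : Quad q B) (x : V) : B x x = 0 := by
  have h1 := h.pol x x
  rw [h.h2, h.q0, h.h2, zero_add] at h1
  exact h1.symm

theorem zero (h : Quad q B) (x : V) : B 0 x = 0 := by
  have := h.add 0 0 x
  simpa using this

end Quad

theorem h2_prod {V : Type*} [AddCommGroup V] (h2 : ∀ x : V, x + x = 0) (x : V × V) : x + x = 0 := by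
  ext <;> simp [h2]

/-- the subgroup `0 × V` -/
def W0 (V : Type*) [AddCommGroup V] : AddSubgroup (V × V) := (AddMonoidHom.fst V V).ker

theorem mem_W0 (x : V × V) : x ∈ W0 V ↔ x.1 = 0 := Iff.rfl

/-- the graph -/
def gr (q : V → V) : Set (V × V) := {p | p.2 = q p.1}

theorem mem_gr (q : V → V) (x : V × V) : x ∈ gr q ↔ x.2 = q x.1 := Iff.rfl

theorem Quad.qs {q : V → V} {B : V → V → V} (h : Quad q B) : QS (gr q) (W0 V) := by
  refine ⟨?_, ?_, ?_⟩
  · rintro ⟨x, y⟩ hx ⟨x', y'⟩ hx'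
    rw [mem_gr] at hx hx'
    simp only at hx hx'
    subst hx hx'
    obtain ⟨a, ha⟩ : ∃ a, a = x + x' := ⟨_, rfl⟩
    have hxa : x + a = x' := by rw [ha, ← add_assoc, h.h2, zero_add]
    let t0 : V × V → V × V := fun p => (p.1 + a, p.2 + B p.1 a + q a)
    have hinv : Function.Involutive t0 := by
      rintro ⟨u, v⟩
      have g1 := h.h2 a
      have g2 := h.h2 (q a)
      have g3 := h.h2 (B u a)
      simp only [t0, h.add, h.self]
      ext
      · simp only; linear_combination (norm := module) g1
      · simp only; linear_combination (norm := module) g2 + g3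
    have ht : ∀ p, (Function.Involutive.toPerm t0 hinv) p = (p.1 + a, p.2 + B p.1 a + q a) := fun _ => rfl
    refine ⟨(Function.Involutive.toPerm t0 hinv), ⟨?_, ?_⟩, ⟨?_, ?_⟩, ?_⟩
    · rintro ⟨x1, y1⟩ ⟨x2, y2⟩ ⟨x3, y3⟩
      have g1 := h.h2 a
      have g2 := h.h2 (q a)
      simp only [ht, Prod.mk_add_mk, h.add]
      ext
      · simp only; linear_combination (norm := module) - g1
      · simp only; linear_combination (norm := module) - g2
    · rintro ⟨u, v⟩
      simp only [mem_gr, ht, h.pol]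
      rw [show q u + q a + B u a = q u + B u a + q a by abel]
      simp
    · rintro ⟨u, v⟩ hw
      rw [mem_W0] at hw
      simp only at hw
      subst hw
      simp [ht, h.zero]
    · rintro ⟨u, v⟩
      rw [mem_W0]
      simp only [ht, Prod.mk_add_mk, Prod.fst_add, Prod.fst_zero]
      have g1 := h.h2 a
      have g2 := h.h2 u
      linear_combination (norm := module) g1 + g2
    · rw [ht]
      simp only [Prod.mk.injEq]
      rw [← hxa, h.pol]
      exact ⟨rfl, by abel⟩
  · rintro ⟨x, y⟩
    refine ⟨(x, q x), rfl, ?_⟩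
    rw [mem_W0]; simp [h.h2]
  · rintro ⟨x, y⟩ hx ⟨x', y'⟩ hx' hxx
    rw [mem_gr] at hx hx'
    simp only at hx hx'
    subst hx hx'
    rw [mem_W0] at hxx
    simp only [Prod.mk_add_mk] at hxx
    have : x = x' := by
      have := h.h2 x'
      linear_combination (norm := module) hxx - this
    rw [this]

theorem Quad.gg {q : V → V} {B : V → V → V} (h : Quad q B)
    (apn : ∀ x a, a ≠ 0 → B x a = 0 → x = 0 ∨ x = a)
    (sp : ∀ D : V →+ V × V, (∀ u v, D (B u v) = 0) → ∀ x, D x = 0)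
    (card : 16 ≤ (gr q).ncard) : GG (gr q) := by
  have h2' := h2_prod h.h2
  refine ⟨h2', by simp [mem_gr, h.q0], ?_, ?_, card⟩
  · rintro ⟨x, x'⟩ hx ⟨y, y'⟩ hy ⟨z, z'⟩ hz ⟨w, w'⟩ hw hs
    rw [mem_gr] at hx hy hz hw
    simp only at hx hy hz hw
    subst hx hy hz hw
    simp only [Prod.mk_add_mk, Prod.mk_eq_zero] at hs
    obtain ⟨s1, s2⟩ := hs
    have hw : w = x + y + z := by
      have := h.h2 w
      linear_combination (norm := module) this - s1
    rw [hw] at s2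
    have hB : B (x + y) (x + z) = 0 := by
      simp only [h.pol, h.add, h.add', h.self] at s2 ⊢
      have g1 := h.h2 (q x)
      have g2 := h.h2 (q y)
      have g3 := h.h2 (q z)
      rw [h.symm y x]
      linear_combination (norm := module) s2 - g1 - g2 - g3
    by_cases hxz : x + z = 0
    · right; left
      have : x = z := by
        have := h.h2 z
        linear_combination (norm := module) hxz - this
      rw [this]
    · rcases apn _ _ hxz hB with h1 | h1
      · left
        have : x = y := by
          have := h.h2 y
          linear_combination (norm := module) h1 - this
        rw [this]
      · right; right
        have h3 : y = z := add_left_cancel h1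
        have : w = x := by rw [hw, h3, add_assoc, h.h2, add_zero]
        rw [this]
  · intro f hf hfix
    have h0 : f 0 = 0 := hfix 0 (by simp [mem_gr, h.q0])
    have hadd : ∀ x y, f (x + y) = f x + f y := by
      intro x y
      have := hf.1 x y 0
      simpa [h0] using this
    have hk : ∀ v, f (0, v) + (0, v) = 0 := by
      refine sp (AddMonoidHom.mk' (fun v => f (0, v) + (0, v)) ?_) ?_
      · intro a b
        have : ((0, a + b) : V × V) = (0, a) + (0, b) := by simp
        rw [this, hadd]; abel
      · intro u v
        change f (0, B u v) + (0, B u v) = 0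
        have e : ((0, B u v) : V × V) = (u, q u) + (v, q v) + (u + v, q (u + v)) := by
          simp only [Prod.mk_add_mk, h.pol]
          have g1 := h.h2 u
          have g2 := h.h2 v
          have g3 := h.h2 (q u)
          have g4 := h.h2 (q v)
          ext
          · simp only; linear_combination (norm := module) - g1 - g2
          · simp only; linear_combination (norm := module) - g3 - g4
        rw [e, hadd, hadd, hfix _ rfl, hfix _ rfl, hfix _ rfl, h2']
    ext1 p
    obtain ⟨x, y⟩ := p
    have e : ((x, y) : V × V) = (x, q x) + (0, y - q x) := by simp
    have h3 := hk (y - q x)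
    have h4 := h2' (0, y - q x)
    have h5 : f (0, y - q x) = (0, y - q x) := by
      linear_combination (norm := module) h3 - h4
    change f (x, y) = (x, y)
    rw [e, hadd, hfix _ rfl, h5]

theorem ea [Finite V] [Module (ZMod 2) V] {f g : V → V} {Bf Bg : V → V → V} (hf : Quad f Bf) (hg : Quad g Bg)
    (hG : GG (gr g)) (hc : CCZEquivalent f g) :
    ∃ L M : V ≃+ V, ∀ x z, M (Bf x z) = Bg (L x) (L z) := by
  obtain ⟨A, c, hA, hb, him⟩ := hc
  have h2' := h2_prod hf.h2
  have hbφ : Function.Bijective (fun p => A p + c) :=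
    (Equiv.addRight c).bijective.comp hb
  obtain ⟨φ, hφ⟩ : ∃ φ : Equiv.Perm (V × V), ∀ p, φ p = A p + c :=
    ⟨Equiv.ofBijective _ hbφ, fun _ => rfl⟩
  have hφa : ∀ x y z, φ (x + y + z) = φ x + φ y + φ z := by
    intro x y z
    simp only [hφ, hA.map_add]
    have := h2' c
    linear_combination (norm := module) - this
  have hφG : ∀ x, φ x ∈ gr g ↔ x ∈ gr f := by
    intro x
    have : gr g = (fun p => A p + c) '' gr f := him.symm
    rw [this, hφ]
    exact hbφ.1.mem_set_image
  obtain ⟨W', hW'⟩ := exists_image h2' hφa (W0 V)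
  have hQ' : QS (gr g) W' := hf.qs.transport h2' hφa hφG hW'
  obtain ⟨h, hh, hhW⟩ := yoshiara hG hQ' hg.qs
  obtain ⟨ψ, hψ⟩ : ∃ ψ : V × V → V × V, ∀ p, ψ p = h (φ p) := ⟨_, fun _ => rfl⟩
  have hψi : Function.Injective ψ := by
    intro a b hab
    rw [hψ, hψ] at hab
    exact φ.injective (h.injective hab)
  have hψa : ∀ x y z, ψ (x + y + z) = ψ x + ψ y + ψ z := by
    intro x y z
    simp only [hψ, hφa, hh.1]
  have hψG : ∀ x, x ∈ gr f → ψ x ∈ gr g := by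
    intro x hx
    rw [hψ, hh.2, hφG]; exact hx
  have hψW : ∀ w, w ∈ W0 V ↔ ψ w + ψ 0 ∈ W0 V := by
    intro w
    rw [hW', hhW, hψ, hψ]
    have e1 := hh.1 (φ w) (φ 0) 0
    have e2 := h2' (h 0)
    rw [add_zero] at e1
    have : h (φ w + φ 0) + h 0 = h (φ w) + h (φ 0) := by
      linear_combination (norm := module) e1 + e2
    rw [this]
  obtain ⟨Λ, hΛ⟩ : ∃ Λ : V × V →+ V × V, ∀ x, Λ x = ψ x + ψ 0 := ⟨lin ψ h2' hψa, fun _ => rfl⟩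
  have hΛi : ∀ x, Λ x = 0 → x = 0 := by
    intro x hx
    rw [hΛ] at hx
    apply hψi
    have := h2' (ψ 0)
    linear_combination (norm := module) hx - this
  have hΛW : ∀ w, w.1 = 0 ↔ (Λ w).1 = 0 := by
    intro w
    rw [hΛ]; exact hψW w
  let L0 : V →+ V := (AddMonoidHom.fst V V).comp (Λ.comp (AddMonoidHom.inl V V))
  let M0 : V →+ V := (AddMonoidHom.snd V V).comp (Λ.comp (AddMonoidHom.inr V V))
  have hL0 : ∀ x, L0 x = (Λ (x, 0)).1 := fun _ => rfl
  have hM0 : ∀ x, M0 x = (Λ (0, x)).2 := fun _ => rfl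
  have hLi : Function.Injective L0 := by
    rw [injective_iff_map_eq_zero]
    intro x hx
    rw [hL0, ← hΛW] at hx
    exact hx
  have hMi : Function.Injective M0 := by
    rw [injective_iff_map_eq_zero]
    intro x hx
    rw [hM0] at hx
    have h1 := (hΛW (0, x)).1 rfl
    have := hΛi (0, x) (Prod.ext h1 hx)
    exact congrArg Prod.snd this
  refine ⟨AddEquiv.ofBijective L0 (Finite.injective_iff_bijective.1 hLi),
    AddEquiv.ofBijective M0 (Finite.injective_iff_bijective.1 hMi), fun x z => ?_⟩
  change M0 (Bf x z) = Bg (L0 x) (L0 z)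
  have hu : ∀ x y, (ψ (x, y)).1 = L0 x + (ψ 0).1 := by
    intro x y
    have e : ((x, y) : V × V) = (x, 0) + (0, y) := by simp
    have h1 : (Λ (x, y)).1 = L0 x := by
      rw [e, map_add, Prod.fst_add, (hΛW (0, y)).1 rfl, add_zero, hL0]
    rw [hΛ, Prod.fst_add] at h1
    have := hf.h2 (ψ 0).1
    linear_combination (norm := module) h1 - this
  have hu2 : ∀ x, (ψ (x, f x)).2 = g (L0 x + (ψ 0).1) := by
    intro x
    rw [← hu x (f x)]
    exact hψG (x, f x) rfl
  have hu0 : (ψ 0).2 = g (ψ 0).1 := hψG 0 hf.q0.symm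
  have e : ((0, Bf x z) : V × V) = (x, f x) + (z, f z) + (x + z, f (x + z)) := by
    simp only [Prod.mk_add_mk, hf.pol]
    have g1 := hf.h2 x
    have g2 := hf.h2 z
    have g3 := hf.h2 (f x)
    have g4 := hf.h2 (f z)
    ext
    · simp only; linear_combination (norm := module) - g1 - g2
    · simp only; linear_combination (norm := module) - g3 - g4
  rw [hM0, hΛ, e, hψa, Prod.snd_add, Prod.snd_add, Prod.snd_add, hu2, hu2, hu2, hu0, map_add]
  simp only [hg.pol, hg.add]
  have g1 := hg.h2 (g (ψ 0).1)
  have g2 := hg.h2 (g (L0 x))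
  have g3 := hg.h2 (g (L0 z))
  have g4 := hg.h2 (Bg (L0 x) (ψ 0).1)
  have g5 := hg.h2 (Bg (L0 z) (ψ 0).1)
  linear_combination (norm := module) (2 : ℤ) • g1 + g2 + g3 + g4 + g5

end Graph
end TPZ

namespace TPZ

section Final

variable {K : Type*} [Field K] [Algebra (ZMod 2) K]

theorem k2 (x : K) : x + x = 0 := by
  linear_combination x * two0 (K := K)

theorem kk2 (x : K × K) : x + x = 0 := h2_prod k2 x

/-- polarisation of the Taniguchi function -/
def Bt (σ : K ≃ₐ[ZMod 2] K) (α β : K) (u v : K × K) : K × K :=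
  (b1 σ α β u.1 u.2 v.1 v.2, u.1 * v.2 + u.2 * v.1)

/-- polarisation of the Pott-Zhou function -/
def Bp (τ ρ : K ≃ₐ[ZMod 2] K) (γ : K) (u v : K × K) : K × K :=
  (τ u.1 * v.1 + u.1 * τ v.1 + γ * ρ (τ u.2 * v.2 + u.2 * τ v.2), u.1 * v.2 + u.2 * v.1)

theorem quad_t {σ : K ≃ₐ[ZMod 2] K} {k : ℕ} (hσ : ∀ x, σ x = x ^ 2 ^ k) (α β : K) :
    Quad (taniguchi k α β) (Bt σ α β) := by
  have hf : ∀ p : K × K, taniguchi k α β p = (σ (σ (σ p.1)) * σ (σ p.1) + α * σ (σ p.1) * σ p.2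
      + β * (σ p.2 * p.2), p.1 * p.2) := by
    intro p
    simp only [taniguchi, hσ]
    congr 1
    ring
  refine ⟨kk2, ?_, ?_, ?_⟩
  · simp [hf]
  · rintro ⟨x, y⟩ ⟨z, w⟩
    simp only [hf, Bt, b1, Prod.mk_add_mk, map_add]
    ext <;> simp only <;> ring
  · rintro ⟨x, y⟩ ⟨z, w⟩ ⟨u, v⟩
    simp only [Bt, b1, Prod.mk_add_mk, map_add]
    ext <;> simp only <;> ring

theorem quad_p {τ ρ : K ≃ₐ[ZMod 2] K} {ℓ s : ℕ} (hτ : ∀ x, τ x = x ^ 2 ^ ℓ)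
    (hρ : ∀ x, ρ x = x ^ 2 ^ s) (γ : K) :
    Quad (pottZhou ℓ s γ) (Bp τ ρ γ) := by
  have hf : ∀ p : K × K, pottZhou ℓ s γ p = (τ p.1 * p.1 + γ * ρ (τ p.2 * p.2), p.1 * p.2) := by
    intro p
    simp only [pottZhou, hτ, hρ]
    congr 1
    ring
  refine ⟨kk2, ?_, ?_, ?_⟩
  · simp [hf]
  · rintro ⟨x, y⟩ ⟨z, w⟩
    simp only [hf, Bp, Prod.mk_add_mk, map_add, map_mul]
    ext <;> simp only <;> ring
  · rintro ⟨x, y⟩ ⟨z, w⟩ ⟨u, v⟩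
    simp only [Bp, Prod.mk_add_mk, map_add, map_mul]
    ext <;> simp only <;> ring

theorem apn_p {τ ρ : K ≃ₐ[ZMod 2] K} {ℓ s : ℕ} (hτ : ∀ x, τ x = x ^ 2 ^ ℓ)
    (hρ : ∀ x, ρ x = x ^ 2 ^ s) (γ : K) (hγ : ∀ x, x ^ 3 ≠ γ) (hℓ : Odd ℓ) (hs : Even s)
    (hfix : ∀ x, τ x = x → x = 0 ∨ x = 1) (v a : K × K) (ha : a ≠ 0) (h : Bp τ ρ γ v a = 0) :
    v = 0 ∨ v = a := by
  obtain ⟨x, y⟩ := v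
  obtain ⟨z, w⟩ := a
  simp only [Bp, Prod.mk_eq_zero] at h
  obtain ⟨h1, h2⟩ := h
  have t0 := two0 (K := K)
  obtain ⟨c, hx, hy⟩ : ∃ c, x = c * z ∧ y = c * w := by
    by_cases hz : z = 0
    · have hw : w ≠ 0 := by rintro rfl; exact ha (by simp [hz])
      refine ⟨y / w, ?_, by field_simp⟩
      subst hz
      simp only [mul_zero, add_zero, mul_eq_zero] at h2 ⊢
      tauto
    · refine ⟨x / z, by field_simp, ?_⟩
      field_simp
      linear_combination h2 - x * w * t0
  subst hx hy
  simp only [map_add, map_mul] at h1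
  by_cases hθ : τ c + c = 0
  · have : τ c = c := by linear_combination hθ - c * t0
    rcases hfix c this with rfl | rfl
    · left; simp
    · right; simp
  · exfalso
    have h3 : (τ c + c) * (τ z * z) + γ * (ρ (τ c + c) * ρ (τ w * w)) = 0 := by
      simp only [map_add, map_mul]
      linear_combination h1
    generalize τ c + c = θ at *
    have hw : w ≠ 0 := by
      rintro rfl
      simp only [map_zero, mul_zero, add_zero, mul_eq_zero, hθ, false_or] at h3
      have : z = 0 := by simpa using h3
      exact ha (by simp [this])
    obtain ⟨a, ha⟩ : ∃ a, 2 ^ s = 3 * a + 1 := by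
      obtain ⟨r, rfl⟩ := hs
      have : 2 ^ (r + r) % 3 = 1 := by
        rw [← two_mul, pow_mul, Nat.pow_mod]; simp
      exact ⟨2 ^ (r + r) / 3, by omega⟩
    obtain ⟨b, hb⟩ : ∃ b, 2 ^ ℓ + 1 = 3 * b := by
      obtain ⟨r, rfl⟩ := hℓ
      have : 2 ^ (2 * r + 1) % 3 = 2 := by
        rw [pow_succ, pow_mul, Nat.mul_mod, Nat.pow_mod]; simp
      generalize 2 ^ (2 * r + 1) = n at this ⊢
      exact ⟨(n + 1) / 3, by omega⟩
    have hp : ∀ x, τ x * x = x ^ (3 * b) := by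
      intro x; rw [hτ, ← pow_succ, hb]
    rw [hp, hp, hρ, hρ, ha] at h3
    apply hγ (z ^ b / (θ ^ a * w ^ (b * (3 * a + 1))))
    rw [div_pow, div_eq_iff (by positivity)]
    apply mul_left_cancel₀ hθ
    linear_combination h3 - γ * θ ^ (3 * a + 1) * w ^ (3 * b * (3 * a + 1)) * t0

variable [Finite K]

theorem span_p {τ ρ : K ≃ₐ[ZMod 2] K} (hτ2 : τ * τ ≠ 1) (γ : K)
    (D : K × K →+ (K × K) × (K × K)) (hD : ∀ u v, D (Bp τ ρ γ u v) = 0) (x : K × K) : D x = 0 := by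
  have h2 : ∀ t, D (0, t) = 0 := by
    intro t
    have := hD (t, 0) (0, 1)
    simpa [Bp] using this
  have key : ∀ F : (K × K) × (K × K) →+ K, ∀ t, F (D (t, 0)) = 0 := by
    intro F
    refine inj hτ2 (F.comp (D.comp (AddMonoidHom.inl K K))) ?_
    intro y w
    have := hD (y, 0) (w, 0)
    simp only [Bp, map_zero, mul_zero, zero_mul, add_zero] at this
    change F (D (τ y * w + y * τ w, 0)) = 0
    rw [this, map_zero]
  obtain ⟨x, y⟩ := x
  have h1 : D (x, 0) = 0 := by
    have a1 := key ((AddMonoidHom.fst K K).comp (AddMonoidHom.fst _ _)) x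
    have a2 := key ((AddMonoidHom.snd K K).comp (AddMonoidHom.fst _ _)) x
    have a3 := key ((AddMonoidHom.fst K K).comp (AddMonoidHom.snd _ _)) x
    have a4 := key ((AddMonoidHom.snd K K).comp (AddMonoidHom.snd _ _)) x
    exact Prod.ext (Prod.ext a1 a2) (Prod.ext a3 a4)
  have e : ((x, y) : K × K) = (x, 0) + (0, y) := by simp
  rw [e, map_add, h1, h2, add_zero]

theorem contra {σ τ ρ : K ≃ₐ[ZMod 2] K} (hσ2 : σ * σ ≠ 1) (hσ3 : σ * σ * σ ≠ 1) {α β γ : K}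
    (hα : α ≠ 0) (hβ : β ≠ 0) (L M : (K × K) ≃+ (K × K))
    (h : ∀ u v, M (Bt σ α β u v) = Bp τ ρ γ (L u) (L v)) : False := by
  have t0 := two0 (K := K)
  let E : K × K →+ K × K := (AddMonoidHom.inl K K).comp (AddMonoidHom.fst K K)
  let N : K × K →+ K × K := (AddMonoidHom.inr K K).comp (AddMonoidHom.snd K K)
  have hE : ∀ u, E u = (u.1, 0) := fun _ => rfl
  have hN : ∀ u, N u = (0, u.2) := fun _ => rfl
  have hEN : ∀ u v, Bp τ ρ γ (E u) v + Bp τ ρ γ u (E v) = N (Bp τ ρ γ u v) := by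
    rintro ⟨x, y⟩ ⟨z, w⟩
    simp only [hE, hN, Bp, Prod.mk_add_mk, map_zero, mul_zero, zero_mul, add_zero, zero_add]
    ext
    · simp only; linear_combination (τ x * z + x * τ z) * t0
    · rfl
  obtain ⟨X, hX⟩ : ∃ X : K × K →+ K × K, ∀ u, X u = L.symm (E (L u)) :=
    ⟨L.symm.toAddMonoidHom.comp (E.comp L.toAddMonoidHom), fun _ => rfl⟩
  obtain ⟨Y, hY⟩ : ∃ Y : K × K →+ K × K, ∀ u, Y u = M.symm (N (M u)) :=
    ⟨M.symm.toAddMonoidHom.comp (N.comp M.toAddMonoidHom), fun _ => rfl⟩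
  have hXY : ∀ u v, Bt σ α β (X u) v + Bt σ α β u (X v) = Y (Bt σ α β u v) := by
    intro u v
    apply M.injective
    rw [map_add, h, h, hY, hX, hX]
    simp only [AddEquiv.apply_symm_apply]
    rw [hEN, h]
  have hXX : ∀ u, X (X u) = X u := by
    intro u; simp [hX, hE]
  have hXs : ∀ x y, X (x, y) = ((X (x, 0)).1 + (X (0, y)).1, (X (x, 0)).2 + (X (0, y)).2) := by
    intro x y
    have e : ((x, y) : K × K) = (x, 0) + (0, y) := by simp
    rw [e, map_add]; rfl
  have hYs : ∀ x y, Y (x, y) = ((Y (x, 0)).1 + (Y (0, y)).1, (Y (x, 0)).2 + (Y (0, y)).2) := by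
    intro x y
    have e : ((x, y) : K × K) = (x, 0) + (0, y) := by simp
    rw [e, map_add]; rfl
  let i1 := AddMonoidHom.inl K K
  let i2 := AddMonoidHom.inr K K
  let p1 := AddMonoidHom.fst K K
  let p2 := AddMonoidHom.snd K K
  obtain ⟨p, hP, hQ, hR, hS⟩ := deriv_trivial hσ2 hσ3 hα hβ
    (p1.comp (X.comp i1)) (p1.comp (X.comp i2)) (p2.comp (X.comp i1)) (p2.comp (X.comp i2))
    (p1.comp (Y.comp i1)) (p1.comp (Y.comp i2)) (p2.comp (Y.comp i1)) (p2.comp (Y.comp i2))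
    (by
      intro x y z w
      have := congrArg Prod.fst (hXY (x, y) (z, w))
      rw [hXs x y, hXs z w] at this
      simp only [Bt] at this
      rw [hYs] at this
      exact this)
    (by
      intro x y z w
      have := congrArg Prod.snd (hXY (x, y) (z, w))
      rw [hXs x y, hXs z w] at this
      simp only [Bt] at this
      rw [hYs] at this
      exact this)
  have hXf : ∀ x y, X (x, y) = (p * x, σ (σ p) * y) := by
    intro x y
    have a1 : (X (x, 0)).1 = p * x := hP x
    have a2 : (X (0, y)).1 = 0 := hQ y
    have a3 : (X (x, 0)).2 = 0 := hR x
    have a4 : (X (0, y)).2 = σ (σ p) * y := hS y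
    rw [hXs, a1, a2, a3, a4, add_zero, zero_add]
  have hpp : p * p = p := by
    have := hXX (1, 0)
    rw [hXf, hXf] at this
    simpa using congrArg Prod.fst this
  have hp : p = 0 ∨ p = 1 := by
    rcases eq_or_ne p 0 with h | h
    · exact Or.inl h
    · right; exact mul_left_cancel₀ h (by rw [hpp, mul_one])
  have hEX : ∀ u, E u = L (X (L.symm u)) := by
    intro u; simp [hX]
  rcases hp with rfl | rfl
  · have h1 := hEX (1, 0)
    have : X (L.symm (1, 0)) = 0 := by
      rw [← Prod.mk.eta (p := L.symm (1, 0)), hXf]; simp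
    rw [this, map_zero, hE] at h1
    simpa using congrArg Prod.fst h1
  · have h1 := hEX (0, 1)
    have : X (L.symm (0, 1)) = L.symm (0, 1) := by
      rw [← Prod.mk.eta (p := L.symm (0, 1)), hXf]; simp
    rw [this, AddEquiv.apply_symm_apply, hE] at h1
    simpa using congrArg Prod.snd h1

end Final
end TPZ

/-- For even `m ≥ 4`, an APN Taniguchi function `f_{k,α,β}` with `α ≠ 0` and an APN
Pott-Zhou function `g_{ℓ,s,γ}` (with `gcd(ℓ,m) = 1`, `s` even, `γ` a non-cube) on
`F_{2^m} × F_{2^m}` are CCZ-inequivalent. -/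
theorem taniguchi_pottZhou_inequivalent (m k ℓ s : ℕ) (hm : 4 ≤ m) (hmeven : Even m)
    (hk : 0 < k) (hkm : k < m) (hgk : Nat.gcd k m = 1)
    (hℓ : 0 < ℓ) (hℓm : ℓ < m) (hgl : Nat.gcd ℓ m = 1) (hs : Even s)
    (α β γ : GaloisField 2 m) (hα : α ≠ 0) (hβ : β ≠ 0)
    (hAPN : ∀ x : GaloisField 2 m, x ^ (2 ^ k + 1) + α * x + β ≠ 0)
    (hγ : ∀ x : GaloisField 2 m, x ^ 3 ≠ γ) :
    ¬ CCZEquivalent (taniguchi k α β) (pottZhou ℓ s γ) := by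
  have : Fact (Nat.Prime 2) := ⟨Nat.prime_two⟩
  have hm0 : m ≠ 0 := by omega
  intro hccz
  obtain ⟨φ, hφ⟩ : ∃ φ : GaloisField 2 m ≃ₐ[ZMod 2] GaloisField 2 m,
      φ = FiniteField.frobeniusAlgEquivOfAlgebraic (ZMod 2) (GaloisField 2 m) := ⟨_, rfl⟩
  have hpow : ∀ n x, (φ ^ n) x = x ^ 2 ^ n := by
    intro n x
    induction n generalizing x with
    | zero => simp
    | succ n ih =>
      rw [pow_succ, AlgEquiv.mul_apply, ih, hφ, FiniteField.coe_frobeniusAlgEquivOfAlgebraic]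
      simp only [ZMod.card]
      rw [← pow_mul]
      congr 1
      ring
  have hord : orderOf φ = m := by
    rw [hφ, FiniteField.orderOf_frobeniusAlgEquivOfAlgebraic, GaloisField.finrank 2 hm0]
  have hne : ∀ j c : ℕ, Nat.gcd j m = 1 → 0 < c → c < 4 → φ ^ (j * c) ≠ 1 := by
    intro j c hj hc0 hc h
    have h1 := orderOf_dvd_of_pow_eq_one h
    rw [hord] at h1
    have h3 := (Nat.Coprime.symm hj).dvd_of_dvd_mul_left h1
    have := Nat.le_of_dvd hc0 h3
    omega
  have hs2 : ∀ j : ℕ, Nat.gcd j m = 1 → φ ^ j * φ ^ j ≠ 1 := by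
    intro j hj
    have := hne j 2 hj (by norm_num) (by norm_num)
    rwa [pow_mul, pow_two] at this
  have hs3 : φ ^ k * φ ^ k * φ ^ k ≠ 1 := by
    have := hne k 3 hgk (by norm_num) (by norm_num)
    rwa [pow_mul, pow_succ, pow_two] at this
  have hodd : Odd ℓ := by
    rw [← Nat.not_even_iff_odd]
    intro he
    have := Nat.dvd_gcd he.two_dvd hmeven.two_dvd
    rw [hgl] at this
    omega
  have hfix : ∀ x, (φ ^ ℓ) x = x → x = 0 ∨ x = 1 := by
    intro x hx
    have hit : ∀ j, ((φ ^ ℓ) ^ j) x = x := by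
      intro j
      induction j with
      | zero => simp
      | succ j ih => rw [pow_succ, AlgEquiv.mul_apply, hx, ih]
    obtain ⟨j, hj⟩ := exists_pow_eq_self_of_coprime (n := ℓ) (x := φ) (by rw [hord]; exact hgl)
    have h1 := hit j
    rw [hj] at h1
    have h3 := hpow 1 x
    rw [pow_one, h1] at h3
    rcases eq_or_ne x 0 with h | h
    · exact Or.inl h
    · right
      apply mul_left_cancel₀ h
      rw [mul_one, ← pow_two]
      simpa using h3.symm
  have hqt := TPZ.quad_t (hpow k) α β
  have hqp := TPZ.quad_p (hpow ℓ) (hpow s) γ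
  have hcard : 16 ≤ (TPZ.gr (pottZhou ℓ s γ)).ncard := by
    have h1 : Nat.card (GaloisField 2 m) = 2 ^ m := GaloisField.card 2 m hm0
    have h3 : (Set.range (fun x : GaloisField 2 m => (((x, 0), pottZhou ℓ s γ (x, 0)) :
        (GaloisField 2 m × GaloisField 2 m) × (GaloisField 2 m × GaloisField 2 m)))).ncard
        = 2 ^ m := by
      rw [← h1, ← Set.image_univ, Set.ncard_image_of_injective, Set.ncard_univ]
      intro a b hab
      simpa using congrArg (fun z => z.1.1) hab
    have h4 := Set.ncard_le_ncard (s := (Set.range (fun x : GaloisField 2 m =>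
      (((x, 0), pottZhou ℓ s γ (x, 0)) :
        (GaloisField 2 m × GaloisField 2 m) × (GaloisField 2 m × GaloisField 2 m)))))
      (t := TPZ.gr (pottZhou ℓ s γ)) (by rintro _ ⟨x, rfl⟩; rfl) (Set.toFinite _)
    have h5 : 2 ^ 4 ≤ 2 ^ m := Nat.pow_le_pow_right (by norm_num) hm
    omega
  have hG := hqp.gg (TPZ.apn_p (hpow ℓ) (hpow s) γ hγ hodd hs hfix)
    (TPZ.span_p (hs2 ℓ hgl) γ) hcard
  obtain ⟨L, M, hLM⟩ := TPZ.ea hqt hqp hG hccz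
  exact TPZ.contra (hs2 k hgk) hs3 hα hβ L M hLM
end

section
/- Let m ≥ 4 be even. Let f_{k,0,β} and f_{ℓ,α',β'} with α' ≠ 0 be APN Taniguchi functions on F_{2^m} × F_{2^m}. Then f_{k,0,β} and f_{ℓ,α',β'} are CCZ-inequivalent. -/
namespace TaniAux
open Finset
open scoped Classical

section generic
set_option linter.unusedSectionVars false
variable {V : Type*} [AddCommGroup V] [Fintype V] 

/-- sums of nontrivial characters vanish -/
lemma sum_char_zero (c : V → ℤ) (hc : ∀ v w, c (v + w) = c v * c w) (w0 : V) (h0 : c w0 ≠ 1) :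
    ∑ w, c w = 0 := by
  have h : ∑ w, c w = c w0 * ∑ w, c w := by
    rw [Finset.mul_sum]
    rw [← Equiv.sum_comp (Equiv.addLeft w0) c]
    apply Finset.sum_congr rfl
    intro w _
    simp [hc]
  have h' : (c w0 - 1) * ∑ w, c w = 0 := by linarith
  rcases mul_eq_zero.mp h' with h | h
  · exact absurd (by linarith) h0
  · exact h

/-- sign character of the range of `B u` -/
noncomputable def chi (B : V →+ V →+ V) (u v : V) : ℤ := if v ∈ (B u).range then 1 else -1

lemma chi_sq (B : V →+ V →+ V) (u v : V) : chi B u v * chi B u v = 1 := by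
  unfold chi; split_ifs <;> norm_num

lemma chi_congr {B : V →+ V →+ V} {u u' : V} (h : (B u).range = (B u').range) (v : V) :
    chi B u v = chi B u' v := by
  unfold chi
  by_cases h1 : v ∈ (B u').range
  · rw [if_pos h1, if_pos (h ▸ h1)]
  · rw [if_neg h1, if_neg (h ▸ h1)]

/-- data of a quadratic APN function -/
structure QApn (f : V → V) (B : V →+ V →+ V) : Prop where
  two : ∀ x : V, x + x = 0
  quad : ∀ x y, f (x + y) = f x + f y + B x y
  apn : ∀ u w, u ≠ 0 → B u w = 0 → w = 0 ∨ w = u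

variable {f : V → V} {B : V →+ V →+ V}

lemma QApn.zero (h : QApn f B) : f 0 = 0 := by
  have := h.quad 0 0
  simpa using this

lemma QApn.alt (h : QApn f B) (u : V) : B u u = 0 := by
  have := h.quad u u
  rw [h.two, h.zero, h.two] at this
  simpa using this.symm

lemma QApn.symm (h : QApn f B) (u w : V) : B u w = B w u := by
  have h1 := h.quad u w
  have h2 := h.quad w u
  rw [add_comm w u, h1, add_comm (f w)] at h2
  exact add_left_cancel h2

lemma QApn.eq_of_add (h : QApn f B) {u w : V} (huw : u + w = 0) : w = u := by
  have := h.two u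
  exact add_left_cancel (huw.trans this.symm)

lemma QApn.add_ne (h : QApn f B) {u w : V} (huw : w ≠ u) : u + w ≠ 0 :=
  fun h' => huw (h.eq_of_add h')

lemma QApn.index (h : QApn f B) {u : V} (hu : u ≠ 0) : (B u).range.index = 2 := by
  have h1 : Nat.card (B u).ker = 2 := by
    have : ((B u).ker : Set V) = {0, u} := by
      ext w
      simp only [SetLike.mem_coe, AddMonoidHom.mem_ker, Set.mem_insert_iff, Set.mem_singleton_iff]
      constructor
      · exact h.apn u w hu
      · rintro (rfl | rfl)
        · simp
        · exact h.alt _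
    have h2 : Nat.card (B u).ker = Set.ncard ((B u).ker : Set V) := rfl
    rw [h2, this, Set.ncard_pair hu.symm]
  have h3 := (B u).range.card_mul_index
  have h4 := (B u).ker.card_mul_index
  rw [AddSubgroup.index_ker, h1] at h4
  have hpos : 0 < Nat.card (B u).range := Nat.card_pos
  rw [← h4, mul_comm] at h3
  exact Nat.eq_of_mul_eq_mul_right hpos h3

lemma QApn.chi_mul (h : QApn f B) {u : V} (hu : u ≠ 0) (v w : V) :
    chi B u (v + w) = chi B u v * chi B u w := by
  unfold chi
  have := AddSubgroup.add_mem_iff_of_index_two (h.index hu) (a := v) (b := w)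
  by_cases h1 : v ∈ (B u).range <;> by_cases h2 : w ∈ (B u).range <;> simp [this, h1, h2]

lemma QApn.exists_chi (h : QApn f B) {u : V} (hu : u ≠ 0) : ∃ w, w ∉ (B u).range := by
  by_contra hc
  push Not at hc
  have : (B u).range = ⊤ := by
    rw [eq_top_iff]; intro x _; exact hc x
  have h2 := h.index hu
  rw [this] at h2
  simp at h2

lemma QApn.range_eq_of_le (h : QApn f B) {u w : V} (hu : u ≠ 0) (hw : w ≠ 0)
    (hle : (B u).range ≤ (B w).range) : (B u).range = (B w).range := by
  apply AddSubgroup.eq_of_le_of_card_ge hle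
  have h1 := (B u).range.card_mul_index
  have h2 := (B w).range.card_mul_index
  rw [h.index hu] at h1
  rw [h.index hw] at h2
  omega

lemma QApn.sum_chi (h : QApn f B) {u : V} (hu : u ≠ 0) : ∑ w, chi B u w = 0 := by
  obtain ⟨w0, hw0⟩ := h.exists_chi hu
  exact sum_char_zero _ (h.chi_mul hu) w0 (by simp [chi, hw0])

lemma QApn.sum_chi_mul (h : QApn f B) {u u' : V} (hu : u ≠ 0) (hu' : u' ≠ 0) :
    ∑ w, chi B u w * chi B u' w = if (B u).range = (B u').range then (Fintype.card V : ℤ) else 0 := by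
  split_ifs with hh
  · have : ∀ w, chi B u w * chi B u' w = 1 := by
      intro w
      have : chi B u w = chi B u' w := chi_congr hh w
      rw [this, chi_sq]
    simp [this]
  · have : ∃ w0, chi B u w0 * chi B u' w0 ≠ 1 := by
      by_contra hc
      push Not at hc
      apply hh
      ext w
      have := hc w
      unfold chi at this
      by_cases h1 : w ∈ (B u).range <;> by_cases h2 : w ∈ (B u').range <;> simp_all
    obtain ⟨w0, hw0⟩ := this
    apply sum_char_zero (fun w => chi B u w * chi B u' w) _ w0 hw0
    intro v w
    simp only [h.chi_mul hu, h.chi_mul hu']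
    ring

/-- The difference set of the graph of `f`. -/
def D (f : V → V) : Set (V × V) := {d | ∃ p q, p ≠ q ∧ d = (p + q, f p + f q)}

lemma QApn.mem_D (h : QApn f B) (u v : V) : (u, v) ∈ D f ↔ u ≠ 0 ∧ v + f u ∈ (B u).range := by
  constructor
  · rintro ⟨p, q, hpq, he⟩
    obtain ⟨rfl, rfl⟩ := Prod.mk.inj he
    refine ⟨h.add_ne hpq.symm, q, ?_⟩
    rw [h.quad, map_add, AddMonoidHom.add_apply, h.alt, add_zero]
    rw [← add_assoc, h.two, zero_add]
  · rintro ⟨hu, w, hw⟩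
    refine ⟨u + w, w, ?_, ?_⟩
    · simpa using hu
    · have h1 : v = B u w + f u := by
        rw [hw, add_assoc, h.two, add_zero]
      ext
      · simp [add_assoc, h.two]
      · simp only
        rw [h.quad, h1]
        have := h.two (f w)
        calc B u w + f u = f u + B u w + (f w + f w) := by rw [this]; abel
          _ = _ := by abel

/-- number of representations -/
noncomputable def N (f : V → V) (d : V × V) : ℕ := #{e : V × V | e ∈ D f ∧ d + e ∈ D f}

lemma QApn.ind (h : QApn f B) (u v : V) :
    (2 * (if (u, v) ∈ D f then 1 else 0) : ℤ) = if u = 0 then 0 else 1 + chi B u (v + f u) := by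
  simp only [h.mem_D, chi]
  by_cases hu : u = 0
  · simp [hu]
  · by_cases h1 : v + f u ∈ (B u).range <;> simp [hu, h1]

lemma QApn.four_N (h : QApn f B) (u v : V) :
    (4 * N f (u, v) : ℤ) = ∑ x, if x = 0 ∨ u + x = 0 then 0 else
      ((Fintype.card V : ℤ) + if (B x).range = (B (u + x)).range then
        Fintype.card V * chi B x (v + f x + f (u + x)) else 0) := by
  have h1 : (4 * N f (u, v) : ℤ) = ∑ x, ∑ w, (2 * (if (x, w) ∈ D f then 1 else 0)) *
      (2 * (if (u + x, v + w) ∈ D f then 1 else 0)) := by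
    unfold N
    rw [Finset.card_filter, ← Fintype.sum_prod_type']
    push_cast
    rw [Finset.mul_sum]
    apply Finset.sum_congr rfl
    rintro ⟨x, w⟩ _
    by_cases h1 : (x, w) ∈ D f <;> by_cases h2 : (u + x, v + w) ∈ D f <;> simp [h1, h2]
  rw [h1]
  apply Finset.sum_congr rfl
  intro x _
  simp only [h.ind]
  by_cases hx : x = 0
  · simp [hx]
  by_cases hux : u + x = 0
  · simp [hux]
  simp only [hx, hux, if_false, or_self]
  have h2 : ∀ w, (1 + chi B x (w + f x)) * (1 + chi B (u + x) (v + w + f (u + x))) =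
      1 + chi B x (f x) * chi B x w + chi B (u + x) (v + f (u + x)) * chi B (u + x) w +
        chi B x (f x) * chi B (u + x) (v + f (u + x)) * (chi B x w * chi B (u + x) w) := by
    intro w
    rw [h.chi_mul hx, add_right_comm v w, h.chi_mul hux (v + f (u + x)) w]
    ring
  simp only [h2, Finset.sum_add_distrib, ← Finset.mul_sum, h.sum_chi hx, h.sum_chi hux,
    h.sum_chi_mul hx hux]
  simp only [Finset.sum_const, Finset.card_univ, nsmul_eq_mul, mul_one, mul_zero, add_zero]
  split_ifs with hr
  · have : chi B (u + x) (v + f (u + x)) = chi B x (v + f (u + x)) := chi_congr hr.symm _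
    rw [this, ← h.chi_mul hx]
    have e : f x + (v + f (u + x)) = v + f x + f (u + x) := by abel
    rw [e]; ring
  · simp

/-- the radical -/
def rad (B : V →+ V →+ V) (u : V) : AddSubgroup V where
  carrier := {w | ∀ z, B w z ∈ (B u).range}
  zero_mem' := fun z => by simp
  add_mem' := fun {a b} ha hb z => by
    rw [map_add, AddMonoidHom.add_apply]; exact add_mem (ha z) (hb z)
  neg_mem' := fun {a} ha z => by
    rw [map_neg, AddMonoidHom.neg_apply]; exact neg_mem (ha z)

lemma mem_rad {u w : V} : w ∈ rad B u ↔ ∀ z, B w z ∈ (B u).range := Iff.rfl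

lemma self_mem_rad (u : V) : u ∈ rad B u := fun z => ⟨z, rfl⟩

lemma QApn.eq_range_iff (h : QApn f B) {u x : V} (hu : u ≠ 0) (hx : x ≠ 0) (hux : u + x ≠ 0) :
    (B x).range = (B (u + x)).range ↔ x ∈ rad B u := by
  constructor
  · intro he
    have hle : (B u).range ≤ (B x).range := by
      rintro _ ⟨z, rfl⟩
      have h1 : B (u + x) z ∈ (B x).range := by rw [he]; exact ⟨z, rfl⟩
      have h2 : B x z ∈ (B x).range := ⟨z, rfl⟩
      rw [map_add, AddMonoidHom.add_apply] at h1
      exact (add_mem_cancel_right h2).mp h1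
    have := h.range_eq_of_le hu hx hle
    intro z
    rw [this]; exact ⟨z, rfl⟩
  · intro hr
    have h1 : (B x).range = (B u).range :=
      h.range_eq_of_le hx hu (by rintro _ ⟨z, rfl⟩; exact hr z)
    have h2 : (B (u + x)).range = (B u).range :=
      h.range_eq_of_le hux hu (by
        rintro _ ⟨z, rfl⟩; exact add_mem (self_mem_rad u) hr z)
    rw [h1, h2]

lemma QApn.range_of_rad (h : QApn f B) {u x : V} (hu : u ≠ 0) (hx : x ≠ 0) (hr : x ∈ rad B u) :
    (B x).range = (B u).range :=
  h.range_eq_of_le hx hu (by rintro _ ⟨z, rfl⟩; exact hr z)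

/-- Square of the Walsh sum. -/
lemma QApn.walsh_sq (h : QApn f B) {u : V} (hu : u ≠ 0) (ps : V → ℤ)
    (hps : ∀ v w, ps (v + w) = ps v * ps w) (hps2 : ∀ v, ps v * ps v = 1) :
    (∑ x, chi B u (f x) * ps x) ^ 2 =
      Fintype.card V * ∑ r, if r ∈ rad B u then chi B u (f r) * ps r else 0 := by
  rw [sq, Finset.sum_mul_sum]
  have h1 : ∀ x, ∑ z, chi B u (f x) * ps x * (chi B u (f z) * ps z) =
      ∑ r, chi B u (f r) * ps r * chi B u (B r x) := by
    intro x
    rw [← Equiv.sum_comp (Equiv.addLeft x)]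
    apply Finset.sum_congr rfl
    intro r _
    simp only [Equiv.coe_addLeft]
    rw [h.quad, h.chi_mul hu, h.chi_mul hu, hps, h.symm x r]
    have e1 := chi_sq B u (f x)
    have e2 := hps2 x
    calc _ = (chi B u (f x) * chi B u (f x)) * (ps x * ps x) *
          (chi B u (f r) * ps r * chi B u (B r x)) := by ring
      _ = _ := by rw [e1, e2]; ring
  simp only [h1]
  rw [Finset.sum_comm, Finset.mul_sum]
  apply Finset.sum_congr rfl
  intro r _
  rw [← Finset.mul_sum]
  split_ifs with hr
  · have : ∀ x, chi B u (B r x) = 1 := fun x => by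
      unfold chi; rw [if_pos (hr x)]
    simp [this]; ring
  · have : ∑ x, chi B u (B r x) = 0 := by
      rw [mem_rad] at hr
      push Not at hr
      obtain ⟨z, hz⟩ := hr
      apply sum_char_zero (fun x => chi B u (B r x)) _ z
      · simp [chi, hz]
      · intro v w
        simp only [map_add]
        exact h.chi_mul hu _ _
    rw [this]; simp

lemma exists_sign [Module (ZMod 2) V] {u : V} (hu : u ≠ 0) : ∃ ps : V → ℤ,
    (∀ v w, ps (v + w) = ps v * ps w) ∧ (∀ v, ps v * ps v = 1) ∧ ps u = -1 := by
  have : ∃ φ : Module.Dual (ZMod 2) V, φ u ≠ 0 := by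
    by_contra hc
    push Not at hc
    exact hu ((Module.forall_dual_apply_eq_zero_iff (ZMod 2) u).mp hc)
  obtain ⟨φ, hφ⟩ := this
  refine ⟨fun v => if φ v = 0 then 1 else -1, ?_, ?_, by simp [hφ]⟩
  · intro v w
    simp only [map_add]
    generalize φ v = a
    generalize φ w = b
    revert a b; decide
  · intro v
    simp only
    split_ifs <;> norm_num

lemma QApn.four_dvd_rad [Module (ZMod 2) V] (h : QApn f B) {m : ℕ}
    (hcard : Fintype.card V = (2 ^ m) ^ 2) {u : V} (hu : u ≠ 0) :
    4 ∣ Fintype.card (rad B u) := by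
  have hdvd : Fintype.card (rad B u) ∣ 2 ^ (2 * m) := by
    have h1 : Nat.card (rad B u) ∣ Nat.card V := AddSubgroup.card_addSubgroup_dvd_card _
    rw [Nat.card_eq_fintype_card, Nat.card_eq_fintype_card, hcard, ← pow_mul, mul_comm m] at h1
    exact h1
  obtain ⟨r, _, hr⟩ := (Nat.dvd_prime_pow Nat.prime_two).mp hdvd
  by_cases hr2 : 2 ≤ r
  · rw [hr]; exact pow_dvd_pow 2 hr2
  exfalso
  have hle : Fintype.card (rad B u) ≤ 2 := by
    rw [hr]; interval_cases r <;> norm_num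
  have hmem : ∀ w, w ∈ rad B u ↔ w = 0 ∨ w = u := by
    intro w
    constructor
    · intro hw
      by_contra hc
      push Not at hc
      have : ({0, u, w} : Finset V) ⊆ Finset.univ.filter (· ∈ rad B u) := by
        intro z hz
        simp only [Finset.mem_insert, Finset.mem_singleton] at hz
        simp only [Finset.mem_filter, Finset.mem_univ, true_and]
        rcases hz with rfl | rfl | rfl
        · exact zero_mem _
        · exact self_mem_rad _
        · exact hw
      have h3 := Finset.card_le_card this
      rw [← Fintype.card_subtype, Finset.card_eq_three.mpr ⟨0, u, w, hu.symm, hc.1.symm, hc.2.symm, rfl⟩] at h3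
      have : Fintype.card {x // x ∈ rad B u} = Fintype.card (rad B u) := Fintype.card_congr (Equiv.refl _)
      omega
    · rintro (rfl | rfl)
      · exact zero_mem _
      · exact self_mem_rad _
  obtain ⟨ps, hp1, hp2, hp3⟩ : ∃ ps : V → ℤ,
    (∀ v w, ps (v + w) = ps v * ps w) ∧ (∀ v, ps v * ps v = 1) ∧ ps u = chi B u (f u) := by
    by_cases hh : f u ∈ (B u).range
    · exact ⟨fun _ => 1, by simp, by simp, by simp [chi, hh]⟩
    · obtain ⟨ps, a, b, c⟩ := exists_sign hu
      exact ⟨ps, a, b, by simp [chi, hh, c]⟩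
  have hw := h.walsh_sq hu ps hp1 hp2
  have hp0 : ps 0 = 1 := by
    have h1 := hp1 0 0
    have h2 := hp2 0
    rw [add_zero, h2] at h1
    exact h1
  have hsum : (∑ r, if r ∈ rad B u then chi B u (f r) * ps r else 0) = 2 := by
    rw [← Finset.sum_filter]
    have : Finset.univ.filter (· ∈ rad B u) = ({0, u} : Finset V) := by
      ext z; simp [hmem]
    rw [this, Finset.sum_pair hu.symm, h.zero, hp0, hp3, chi_sq]
    simp [chi]
  rw [hsum, hcard] at hw
  push_cast at hw
  generalize (∑ x, chi B u (f x) * ps x) = W at hw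
  have hsq : IsSquare (2 : ℚ) := by
    refine ⟨(W : ℚ) / 2 ^ m, ?_⟩
    have hw' : (W : ℚ) ^ 2 = (2 ^ m) ^ 2 * 2 := by exact_mod_cast hw
    field_simp
    linarith
  have h2 : ¬ IsSquare (2 : ℚ) := by
    have : ((2 : ℕ) : ℚ) = 2 := by norm_num
    rw [← this, Rat.isSquare_natCast_iff]
    exact Nat.prime_two.prime.irreducible.not_isSquare
  exact h2 hsq

lemma QApn.N_ne [Module (ZMod 2) V] (h : QApn f B) {m : ℕ} (hm : 1 ≤ m)
    (hcard : Fintype.card V = (2 ^ m) ^ 2) {u : V} (v : V) (hu : u ≠ 0) :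
    (Fintype.card V : ℤ) ∣ N f (u, v) := by
  have h4 := h.four_N u v
  set s := chi B u (v + f u) with hs
  have key : ∀ x, (if x = 0 ∨ u + x = 0 then (0 : ℤ) else
      ((Fintype.card V : ℤ) + if (B x).range = (B (u + x)).range then
        Fintype.card V * chi B x (v + f x + f (u + x)) else 0)) =
      Fintype.card V * (1 + (if x ∈ rad B u then s else 0) -
        (if x = 0 then 1 + s else 0) - (if x = u then 1 + s else 0)) := by
    intro x
    by_cases hx : x = 0
    · simp [hx, hu.symm, zero_mem]
    by_cases hxu : x = u
    · subst hxu; simp [hx, h.two, self_mem_rad]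
    have hux := h.add_ne hxu
    simp only [hx, hux, hxu, or_self, if_false, h.eq_range_iff hu hx hux]
    split_ifs with hr
    · have e1 : chi B x (v + f x + f (u + x)) = s := by
        have hrg := h.range_of_rad hu hx hr
        have : v + f x + f (u + x) = (v + f u) + B u x := by
          rw [h.quad]
          have := h.two (f x)
          calc _ = v + f u + B u x + (f x + f x) := by abel
            _ = _ := by rw [this, add_zero]
        have e2 : chi B x (v + f x + f (u + x)) = chi B u (v + f x + f (u + x)) := chi_congr hrg _
        rw [e2, this, h.chi_mul hu]
        have : chi B u (B u x) = 1 := by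
          unfold chi; rw [if_pos ⟨x, rfl⟩]
        rw [this, mul_one]
      rw [e1]
      ring
    · simp
  simp only [key] at h4
  rw [← Finset.mul_sum] at h4
  simp only [Finset.sum_sub_distrib, Finset.sum_add_distrib, Finset.sum_ite_eq', Finset.mem_univ,
    if_true, ← Finset.sum_filter, Finset.sum_const, nsmul_eq_mul, Finset.card_univ, mul_one] at h4
  rw [← Fintype.card_subtype] at h4
  obtain ⟨t, ht⟩ := h.four_dvd_rad hcard hu
  have e : Fintype.card {x // x ∈ rad B u} = 4 * t := by
    rw [← ht]
  rw [e] at h4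
  have hV : ∃ k : ℤ, (Fintype.card V : ℤ) = 4 * k := by
    obtain ⟨j, rfl⟩ := Nat.exists_eq_add_of_le hm
    refine ⟨(2 ^ j) ^ 2, ?_⟩
    rw [hcard]; push_cast; ring
  obtain ⟨k, hk⟩ := hV
  have hs' : ∃ a : ℤ, 1 + s = 2 * a := by
    rw [hs]; unfold chi; split_ifs
    · exact ⟨1, by norm_num⟩
    · exact ⟨0, by norm_num⟩
  obtain ⟨a, ha⟩ := hs'
  refine ⟨k + t * s - a, ?_⟩
  have : (4 * N f (u, v) : ℤ) = 4 * (Fintype.card V * (k + t * s - a)) := by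
    rw [h4]
    have : (Fintype.card V : ℤ) + (4 * t : ℕ) * s - (1 + s) - (1 + s) = 4 * (k + t * s - a) := by
      rw [hk, ha]; push_cast; ring
    rw [this]; ring
  linarith

lemma QApn.N_zero (h : QApn f B) {m : ℕ}
    (hcard : Fintype.card V = (2 ^ m) ^ 2) (hm : 1 ≤ m) (v : V)
    (hev : Even #{u : V | u ≠ 0 ∧ v ∉ (B u).range}) :
    ¬ (Fintype.card V : ℤ) ∣ N f (0, v) := by
  have h4 := h.four_N 0 v
  have key : ∀ x, (if x = 0 ∨ 0 + x = 0 then (0 : ℤ) else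
      ((Fintype.card V : ℤ) + if (B x).range = (B (0 + x)).range then
        Fintype.card V * chi B x (v + f x + f (0 + x)) else 0)) =
      Fintype.card V * (2 - 2 * (if x = 0 then 1 else 0) -
        2 * (if x ≠ 0 ∧ v ∉ (B x).range then 1 else 0)) := by
    intro x
    by_cases hx : x = 0
    · simp [hx]
    · simp only [hx, zero_add, or_self, if_false, if_true]
      rw [add_assoc v, h.two, add_zero]
      unfold chi
      by_cases hv : v ∈ (B x).range <;> simp [hv, hx]
      ring
  simp only [key] at h4
  rw [← Finset.mul_sum] at h4
  simp only [Finset.sum_sub_distrib, ← Finset.mul_sum, Finset.sum_ite_eq', Finset.mem_univ,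
    if_true, ← Finset.sum_filter, Finset.sum_const, nsmul_eq_mul, Finset.card_univ, mul_one] at h4
  obtain ⟨t, ht⟩ := hev
  rw [ht] at h4
  rintro ⟨j, hj⟩
  rw [hj] at h4
  have hpos : (Fintype.card V : ℤ) ≠ 0 := by
    rw [hcard]; positivity
  have h5 : 4 * j = Fintype.card V * 2 - 2 - 2 * ((t + t : ℕ) : ℤ) := by
    apply mul_left_cancel₀ hpos
    linarith
  have hV : ∃ k : ℤ, (Fintype.card V : ℤ) = 4 * k := by
    obtain ⟨j, rfl⟩ := Nat.exists_eq_add_of_le hm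
    refine ⟨(2 ^ j) ^ 2, ?_⟩
    rw [hcard]; push_cast; ring
  obtain ⟨k, hk⟩ := hV
  omega

lemma QApn.even_of_symm (h : QApn f B) (ρ : V ≃ V) (σ : V → V) (hρ : ∀ u, ρ u ≠ 0 ↔ u ≠ 0)
    (hB : ∀ u v, σ v ∈ (B (ρ u)).range ↔ v ∈ (B u).range) (hσ : ∀ v, ∃ w, v = w + σ w) (v : V) :
    Even #{u : V | u ≠ 0 ∧ v ∉ (B u).range} := by
  let F : V → ZMod 2 := fun v => ∑ u : V, if u ≠ 0 ∧ v ∉ (B u).range then 1 else 0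
  have hadd : ∀ v w, F (v + w) = F v + F w := by
    intro v w
    simp only [F]
    rw [← Finset.sum_add_distrib]
    apply Finset.sum_congr rfl
    intro u _
    by_cases hu : u = 0
    · simp [hu]
    · have := AddSubgroup.add_mem_iff_of_index_two (h.index hu) (a := v) (b := w)
      by_cases h1 : v ∈ (B u).range <;> by_cases h2 : w ∈ (B u).range <;> simp [this, h1, h2, hu]
      decide
  have hinv : ∀ v, F (σ v) = F v := by
    intro v
    simp only [F]
    rw [← Equiv.sum_comp ρ]
    apply Finset.sum_congr rfl
    intro u _
    simp only [hB, hρ]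
  have hF : F v = (#{u : V | u ≠ 0 ∧ v ∉ (B u).range} : ℕ) := by
    simp only [F, Finset.card_filter]
    push_cast
    rfl
  obtain ⟨w, rfl⟩ := hσ v
  rw [← ZMod.natCast_eq_zero_iff_even, ← hF, hadd, hinv]
  exact CharTwo.add_self_eq_zero _

lemma mem_D_image {g : V → V} (two : ∀ x : V, x + x = 0) (A : V × V → V × V) (c : V × V)
    (hadd : ∀ x y, A (x + y) = A x + A y) (hinj : Function.Injective A)
    (himg : (fun p => A p + c) '' {p : V × V | p.2 = f p.1} = {p : V × V | p.2 = g p.1})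
    (e : V × V) : A e ∈ D g ↔ e ∈ D f := by
  have hc : c + c = 0 := by ext <;> simp [two]
  constructor
  · rintro ⟨p, q, hpq, he⟩
    have hp : (p, g p) ∈ (fun p => A p + c) '' {p : V × V | p.2 = f p.1} := by
      rw [himg]; rfl
    have hq : (q, g q) ∈ (fun p => A p + c) '' {p : V × V | p.2 = f p.1} := by
      rw [himg]; rfl
    obtain ⟨⟨p1, p2⟩, hp2, hp⟩ := hp
    obtain ⟨⟨q1, q2⟩, hq2, hq⟩ := hq
    simp only [Set.mem_ofPred_eq] at hp2 hq2
    subst hp2 hq2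
    simp only at hp hq
    refine ⟨p1, q1, ?_, ?_⟩
    · rintro rfl
      rw [hp] at hq
      exact hpq (Prod.mk.inj hq).1
    · apply hinj
      rw [he, show (p1 + q1, f p1 + f q1) = (p1, f p1) + (q1, f q1) from rfl, hadd]
      calc (p + q, g p + g q) = (p, g p) + (q, g q) := rfl
        _ = A (p1, f p1) + A (q1, f q1) + (c + c) := by rw [← hp, ← hq]; abel
        _ = _ := by rw [hc, add_zero]
  · rintro ⟨p, q, hpq, rfl⟩
    have hp : A (p, f p) + c ∈ {p : V × V | p.2 = g p.1} := by
      rw [← himg]; exact ⟨_, rfl, rfl⟩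
    have hq : A (q, f q) + c ∈ {p : V × V | p.2 = g p.1} := by
      rw [← himg]; exact ⟨_, rfl, rfl⟩
    simp only [Set.mem_ofPred_eq] at hp hq
    refine ⟨(A (p, f p) + c).1, (A (q, f q) + c).1, ?_, ?_⟩
    · intro h
      have : A (p, f p) + c = A (q, f q) + c := Prod.ext h (by rw [hp, hq, h])
      exact hpq (Prod.mk.inj (hinj (add_right_cancel this))).1
    · rw [← hp, ← hq, show (p + q, f p + f q) = (p, f p) + (q, f q) from rfl, hadd]
      calc A (p, f p) + A (q, f q) = A (p, f p) + A (q, f q) + (c + c) := by rw [hc, add_zero]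
        _ = (A (p, f p) + c) + (A (q, f q) + c) := by abel
        _ = _ := rfl

lemma N_image {g : V → V} (A : V × V → V × V)
    (hadd : ∀ x y, A (x + y) = A x + A y) (hbij : Function.Bijective A)
    (hD : ∀ e, A e ∈ D g ↔ e ∈ D f) (d : V × V) : N g (A d) = N f d := by
  unfold N
  symm
  apply Finset.card_bij (fun e _ => A e)
  · intro e he
    simp only [Finset.mem_filter, Finset.mem_univ, true_and] at he ⊢
    rw [← hadd, hD, hD]; exact he
  · intro a _ b _ hab
    exact hbij.1 hab
  · intro e he
    obtain ⟨e, rfl⟩ := hbij.2 e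
    simp only [Finset.mem_filter, Finset.mem_univ, true_and] at he
    rw [← hadd, hD, hD] at he
    exact ⟨e, by simpa using he, rfl⟩

theorem ccz_polar [Module (ZMod 2) V] {g : V → V} {B' : V →+ V →+ V} (hf : QApn f B)
    (hg : QApn g B') {m : ℕ} (hm : 1 ≤ m) (hcard : Fintype.card V = (2 ^ m) ^ 2)
    (hev : ∀ v, Even #{u : V | u ≠ 0 ∧ v ∉ (B u).range})
    (A : V × V → V × V) (c : V × V)
    (hadd : ∀ x y, A (x + y) = A x + A y) (hbij : Function.Bijective A)
    (himg : (fun p => A p + c) '' {p : V × V | p.2 = f p.1} = {p : V × V | p.2 = g p.1}) :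
    ∃ L M : V →+ V, Function.Bijective L ∧ ∀ u w, M (B u w) = B' (L u) (L w) := by
  have hD := mem_D_image hf.two A c hadd hbij.1 himg
  have h0 : ∀ v, (A (0, v)).1 = 0 := by
    intro v
    by_contra hne
    have h1 := hf.N_zero hcard hm v (hev v)
    rw [← N_image A hadd hbij hD] at h1
    exact h1 (hg.N_ne hm hcard (A (0, v)).2 hne)
  let L : V →+ V := AddMonoidHom.mk' (fun u => (A (u, 0)).1) (fun a b => by
    rw [show (a + b, (0 : V)) = (a, 0) + (b, 0) by simp, hadd]; rfl)
  let M : V →+ V := AddMonoidHom.mk' (fun v => (A (0, v)).2) (fun a b => by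
    rw [show ((0 : V), a + b) = (0, a) + (0, b) by simp, hadd]; rfl)
  let P : V →+ V := AddMonoidHom.mk' (fun u => (A (u, 0)).2) (fun a b => by
    rw [show (a + b, (0 : V)) = (a, 0) + (b, 0) by simp, hadd]; rfl)
  have hA : ∀ u v, A (u, v) = (L u, P u + M v) := by
    intro u v
    rw [show (u, v) = (u, 0) + (0, v) by simp, hadd]
    ext
    · simp [L, h0]
    · simp [P, M]
  have hgr : ∀ x, P x + M (f x) + c.2 = g (L x + c.1) := by
    intro x
    have : A (x, f x) + c ∈ {p : V × V | p.2 = g p.1} := by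
      rw [← himg]; exact ⟨_, rfl, rfl⟩
    rw [hA] at this
    simpa using this
  refine ⟨L, M, ?_, ?_⟩
  · rw [← Finite.surjective_iff_bijective]
    intro y
    obtain ⟨⟨u, v⟩, h⟩ := hbij.2 (y, 0)
    rw [hA] at h
    exact ⟨u, (Prod.mk.inj h).1⟩
  · intro u w
    have e1 := hgr (u + w)
    have e2 := hgr u
    have e3 := hgr w
    have e4 := hgr 0
    rw [hf.quad] at e1
    simp only [map_add, hf.zero, map_zero, zero_add, hg.quad, AddMonoidHom.add_apply] at e1 e2 e3 e4
    have t : ∀ x : V, -x = x := fun x => neg_eq_of_add_eq_zero_left (hf.two x)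
    have s : M (B u w) - B' (L u) (L w) = (P u + P w + (M (f u) + M (f w) + M (B u w)) + c.2)
      - (P u + M (f u) + c.2) - (P w + M (f w) + c.2) + c.2 - B' (L u) (L w) := by abel
    rw [e1, e2, e3, e4] at s
    have : M (B u w) - B' (L u) (L w) = 0 := by
      rw [s]; abel
    exact sub_eq_zero.mp this

end generic

section field
variable {K : Type*} [Field K] [CharP K 2]

/-- Taniguchi function in terms of a ring endomorphism. -/
def T (s : K →+* K) (α β : K) : K × K → K × K := fun p =>
  (s (s (s p.1)) * s (s p.1) + α * s (s p.1) * s p.2 + β * (s p.2 * p.2), p.1 * p.2)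

/-- its polarization -/
def BT (s : K →+* K) (α β : K) : K × K →+ K × K →+ K × K :=
  AddMonoidHom.mk' (fun u => AddMonoidHom.mk' (fun w =>
    (s (s (s u.1)) * s (s w.1) + s (s (s w.1)) * s (s u.1) +
      α * (s (s u.1) * s w.2 + s (s w.1) * s u.2) + β * (s u.2 * w.2 + s w.2 * u.2),
      u.1 * w.2 + w.1 * u.2))
    (fun a b => by
      ext <;> simp <;> ring))
    (fun a b => by
      ext w <;> simp <;> ring)

lemma BT_apply (s : K →+* K) (α β x y a b : K) : BT s α β (x, y) (a, b) =
    (s (s (s x)) * s (s a) + s (s (s a)) * s (s x) +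
      α * (s (s x) * s b + s (s a) * s y) + β * (s y * b + s b * y),
      x * b + a * y) := rfl

lemma two_prod (x : K × K) : x + x = 0 := by
  ext <;> simp [CharTwo.add_self_eq_zero]

lemma qapn_T (s : K →+* K) (α β : K) (h1 : ∀ t, s t = t → t = 0 ∨ t = 1)
    (hP : ∀ x, s x * x + α * x + β ≠ 0) : QApn (T s α β) (BT s α β) where
  two := two_prod
  quad := by
    rintro ⟨x, y⟩ ⟨a, b⟩
    rw [BT_apply]
    simp only [T, Prod.mk_add_mk, map_add]
    ext <;> simp only <;> ring
  apn := by
    rintro ⟨x, y⟩ ⟨a, b⟩ hu hB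
    rw [BT_apply] at hB
    obtain ⟨e1, e2⟩ := Prod.mk.inj hB
    have e2' : x * b = a * y := CharTwo.add_eq_zero.mp e2
    obtain ⟨t, rfl, rfl⟩ : ∃ t, a = t * x ∧ b = t * y := by
      by_cases hx : x = 0
      · have hy : y ≠ 0 := by
          rintro rfl; exact hu (by rw [hx]; rfl)
        refine ⟨b / y, ?_, by field_simp⟩
        rw [hx, zero_mul] at e2'
        rcases mul_eq_zero.mp e2'.symm with h | h
        · rw [h, hx, mul_zero]
        · exact absurd h hy
      · refine ⟨a / x, by field_simp, ?_⟩
        field_simp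
        rw [← e2']; ring
    set r := t + s t with hr
    have hr1 : s r = s t + s (s t) := by simp [hr]
    have hr2 : s (s r) = s (s t) + s (s (s t)) := by simp [hr]
    have e3 : s (s (s x)) * s (s x) * s (s r) + α * s (s x) * s y * s r + β * s y * y * r = 0 := by
      rw [hr2, hr1, hr, ← e1]
      simp only [map_mul]
      ring
    have hr0 : r = 0 := by
      by_contra hne
      by_cases hy : y = 0
      · have hx : x ≠ 0 := by
          rintro rfl; exact hu (by rw [hy]; rfl)
        simp [hy, hx, hne] at e3
      · apply hP (s (s x) * s r / (y * r))
        have hsy : s y ≠ 0 := by simpa using hy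
        have hsr : s r ≠ 0 := by simpa using hne
        simp only [map_div₀, map_mul]
        field_simp
        linear_combination e3
    have ht : s t = t := (CharTwo.add_eq_zero.mp hr0).symm
    rcases h1 t ht with rfl | rfl
    · left; simp
    · right; simp

lemma even_T [Fintype K] (s : K →+* K) (α β : K) (h : QApn (T s α β) (BT s α β))
    (h3 : ∃ t : K, t ≠ 0 ∧ s t * t ≠ 1 ∧ s (s t) * t ≠ 1) (v : K × K) :
    Even #{u : K × K | u ≠ 0 ∧ v ∉ (BT s α β u).range} := by
  obtain ⟨t, ht, h31, h32⟩ := h3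
  have hst : s (s t) ≠ 0 := by simpa using ht
  have hsst : s (s (s t)) ≠ 0 := by simpa using ht
  let ρ : K × K ≃ K × K := Equiv.prodCongr (Equiv.mulLeft₀ t ht) (Equiv.mulLeft₀ (s (s t)) hst)
  let σ : K × K → K × K := fun v => (s (s (s t)) * s (s t) * v.1, s (s t) * t * v.2)
  have hσ1 : Function.Injective σ := by
    rintro ⟨a, b⟩ ⟨a', b'⟩ he
    obtain ⟨e1, e2⟩ := Prod.mk.inj he
    simp only at e1 e2
    rw [mul_left_cancel₀ (mul_ne_zero hsst hst) e1, mul_left_cancel₀ (mul_ne_zero hst ht) e2]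
  have hBB : ∀ u w, BT s α β (ρ u) (ρ w) = σ (BT s α β u w) := by
    rintro ⟨x, y⟩ ⟨a, b⟩
    have hρ : ∀ x y, ρ (x, y) = (t * x, s (s t) * y) := fun _ _ => rfl
    rw [hρ, hρ]
    rw [BT_apply, BT_apply]
    simp only [σ, map_mul]
    ext <;> simp only <;> ring
  have hfin := h.even_of_symm ρ σ ?_ ?_ ?_ v
  · convert hfin
  · intro u
    have : ρ 0 = 0 := by
      ext <;> simp [ρ]
    rw [not_iff_not]
    constructor
    · intro hu; exact ρ.injective (hu.trans this.symm)
    · rintro rfl; exact this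
  · intro u v
    constructor
    · rintro ⟨w, hw⟩
      refine ⟨ρ.symm w, hσ1 ?_⟩
      rw [← hBB, Equiv.apply_symm_apply, hw]
    · rintro ⟨w, rfl⟩
      exact ⟨ρ w, hBB u w⟩
  · rintro ⟨a, b⟩
    have n1 : 1 + s (s (s t)) * s (s t) ≠ 0 := by
      intro h0
      apply h31
      have : s (s (s t * t)) = s (s 1) := by
        simp only [map_mul, map_one]; exact (CharTwo.add_eq_zero.mp h0).symm
      exact s.injective (s.injective this)
    have n2 : 1 + s (s t) * t ≠ 0 := fun h0 => h32 (CharTwo.add_eq_zero.mp h0).symm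
    refine ⟨(a / (1 + s (s (s t)) * s (s t)), b / (1 + s (s t) * t)), ?_⟩
    simp only [σ]
    ext
    · simp only [Prod.mk_add_mk]; field_simp
    · simp only [Prod.mk_add_mk]; field_simp

/-- For `α ≠ 0` there is no nontrivial isometry. -/
lemma isometry_trivial (s : K →+* K) (α β : K) (hα : α ≠ 0) (hβ : β ≠ 0)
    (hind : ∀ c0 c1 c2 c3 : K, (∀ x, c0 * x + c1 * s x + c2 * s (s x) + c3 * s (s (s x)) = 0) →
      c0 = 0 ∧ c1 = 0 ∧ c2 = 0 ∧ c3 = 0)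
    (ps : K × K → K × K) (hadd : ∀ u w, ps (u + w) = ps u + ps w) (hsurj : Function.Surjective ps)
    (hiso : ∀ u w, BT s α β (ps u) (ps w) = BT s α β u w) (u : K × K) : ps u = u := by
  have two : ∀ z : K, z + z = 0 := CharTwo.add_self_eq_zero
  have hdet : ∀ u w, (ps u).1 * (ps w).2 + (ps w).1 * (ps u).2 = u.1 * w.2 + w.1 * u.2 :=
    fun u w => congrArg Prod.snd (hiso u w)
  have hlin : ∀ (c : K) (w : K × K), ps (c * w.1, c * w.2) = (c * (ps w).1, c * (ps w).2) := by
    intro c w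
    have key : ∀ z : K × K, z.1 * (ps (c * w.1, c * w.2)).2 + (ps (c * w.1, c * w.2)).1 * z.2 =
        z.1 * (c * (ps w).2) + (c * (ps w).1) * z.2 := by
      intro z
      obtain ⟨u, rfl⟩ := hsurj z
      rw [hdet]
      linear_combination (-c) * hdet u w
    have k1 := key (0, 1)
    have k2 := key (1, 0)
    simp only [zero_mul, one_mul, mul_one, mul_zero, zero_add, add_zero] at k1 k2
    ext
    · exact k1
    · exact k2
  obtain ⟨a, c, hac⟩ : ∃ a c, ps (1, 0) = (a, c) := ⟨_, _, rfl⟩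
  obtain ⟨b, d, hbd⟩ : ∃ b d, ps (0, 1) = (b, d) := ⟨_, _, rfl⟩
  have hx0 : ∀ x, ps (x, 0) = (x * a, x * c) := by
    intro x
    have := hlin x (1, 0)
    rw [hac] at this
    simpa using this
  have h0y : ∀ y, ps (0, y) = (y * b, y * d) := by
    intro y
    have := hlin y (0, 1)
    rw [hbd] at this
    simpa using this
  have hc1 : ∀ x, _ := fun x => congrArg Prod.fst (hiso (x, 0) (1, 0))
  simp only [hac, hx0, BT_apply, map_mul, map_zero, map_one] at hc1
  obtain ⟨q0, -, -, q3⟩ := hind (β * (s c * c))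
    (α * (s (s a) * s c) + β * (s c * c))
    (s (s (s a)) * s (s a) - 1 + α * (s (s a) * s c))
    (s (s (s a)) * s (s a) - 1) (fun x => by
      linear_combination hc1 x)
  have hc : c = 0 := by simpa [hβ] using q0
  have ha : s a * a = 1 := by
    apply s.injective; apply s.injective
    simp only [map_mul, map_one]
    linear_combination q3
  have hc2 : ∀ x, _ := fun x => congrArg Prod.fst (hiso (0, x) (0, 1))
  simp only [hbd, h0y, BT_apply, map_mul, map_zero, map_one] at hc2
  obtain ⟨-, -, -, r3⟩ := hind (β * (s d * d) - β)
    (α * (s (s b) * s d) + β * (s d * d) - β)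
    (s (s (s b)) * s (s b) + α * (s (s b) * s d))
    (s (s (s b)) * s (s b)) (fun x => by
      linear_combination hc2 x)
  have hb : b = 0 := by simpa using r3
  have had : a * d = 1 := by
    have := hdet (1, 0) (0, 1)
    rw [hac, hbd] at this
    simpa [hb, hc] using this
  have hx : s (s a) * s d = 1 := by
    have := congrArg Prod.fst (hiso (1, 0) (0, 1))
    rw [hac, hbd, BT_apply, BT_apply] at this
    simp only [hb, hc, map_zero, map_one, mul_zero, zero_mul, add_zero, zero_add, mul_one] at this
    exact mul_left_cancel₀ hα (this.trans (mul_one α).symm)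
  have hsad : s a * d = 1 := by
    apply s.injective
    simpa using hx
  have hd : d ≠ 0 := right_ne_zero_of_mul_eq_one had
  have hsa : s a = a := mul_right_cancel₀ hd (hsad.trans had.symm)
  have ha1 : a = 1 := by
    rw [hsa] at ha
    have : (a + 1) * (a + 1) = 0 := by
      have e : (a + 1) * (a + 1) = a * a + 1 + (a + a) := by ring
      rw [e, ha, two, two, add_zero]
    exact CharTwo.add_eq_zero.mp (mul_self_eq_zero.mp this)
  have hd1 : d = 1 := by rw [ha1, one_mul] at had; exact had
  obtain ⟨x, y⟩ := u
  rw [show (x, y) = (x, 0) + (0, y) by simp, hadd, hx0, h0y, ha1, hd1, hb, hc]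
  simp

theorem main_abstract [Fintype K] [Module (ZMod 2) (K × K)] (s s' : K →+* K) (β α' β' : K) (m : ℕ)
    (hm : 1 ≤ m) (hcard : Fintype.card K = 2 ^ m)
    (hβ' : β' ≠ 0) (hα' : α' ≠ 0)
    (h1 : ∀ t, s t = t → t = 0 ∨ t = 1) (h1' : ∀ t, s' t = t → t = 0 ∨ t = 1)
    (h3 : ∃ t : K, t ≠ 0 ∧ s t * t ≠ 1 ∧ s (s t) * t ≠ 1)
    (h4 : ∃ ω : K, ω ≠ 1 ∧ s ω * ω = 1)
    (hind : ∀ c0 c1 c2 c3 : K, (∀ x, c0 * x + c1 * s' x + c2 * s' (s' x) + c3 * s' (s' (s' x)) = 0) →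
      c0 = 0 ∧ c1 = 0 ∧ c2 = 0 ∧ c3 = 0)
    (hP : ∀ x, s x * x + 0 * x + β ≠ 0) (hP' : ∀ x, s' x * x + α' * x + β' ≠ 0) :
    ¬ CCZEquivalent (T s 0 β) (T s' α' β') := by
  rintro ⟨A, c, hlin, hbij, himg⟩
  have hf := qapn_T s 0 β h1 hP
  have hg := qapn_T s' α' β' h1' hP'
  obtain ⟨L, M, hL, hM⟩ := ccz_polar hf hg hm (by rw [Fintype.card_prod, hcard, sq])
    (fun v => by convert even_T s 0 β hf h3 v) A c hlin.map_add hbij himg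
  obtain ⟨ω, hω1, hω⟩ := h4
  have hω0 : ω ≠ 0 := right_ne_zero_of_mul_eq_one hω
  have hsω : s ω ≠ 0 := by simpa using hω0
  let ph : K × K → K × K := fun p => (ω * p.1, s ω * p.2)
  have hph : ∀ u w, BT s 0 β (ph u) (ph w) = BT s 0 β u w := by
    rintro ⟨x, y⟩ ⟨a, b⟩
    simp only [ph]
    rw [BT_apply, BT_apply]
    simp only [map_mul]
    have e1 : s (s ω) * s ω = 1 := by rw [← map_mul, hω, map_one]
    have e2 : s (s (s ω)) * s (s ω) = 1 := by rw [← map_mul, e1, map_one]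
    ext
    · linear_combination (s (s (s x)) * s (s a) + s (s (s a)) * s (s x)) * e2 +
        β * (s y * b + s b * y) * e1
    · linear_combination (x * b + a * y) * hω
  let Le := Equiv.ofBijective L hL
  have hLe : ∀ u, L (Le.symm u) = u := fun u => Le.apply_symm_apply u
  have hLs : ∀ u w, Le.symm (u + w) = Le.symm u + Le.symm w := by
    intro u w
    apply hL.1
    rw [map_add L, hLe, hLe, hLe]
  have hphadd : ∀ u w, ph (u + w) = ph u + ph w := by
    intro u w; simp only [ph]; ext <;> simp <;> ring
  have htriv := isometry_trivial s' α' β' hα' hβ' hind (fun u => L (ph (Le.symm u)))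
    (by
      intro u w
      simp only [hLs, hphadd, map_add])
    (by
      intro z
      obtain ⟨y, rfl⟩ := hL.2 z
      refine ⟨L (ω⁻¹ * y.1, (s ω)⁻¹ * y.2), ?_⟩
      have : Le.symm (L (ω⁻¹ * y.1, (s ω)⁻¹ * y.2)) = (ω⁻¹ * y.1, (s ω)⁻¹ * y.2) :=
        Le.symm_apply_apply _
      simp only [this, ph]
      congr 1
      ext <;> simp only <;> field_simp)
    (by
      intro u w
      rw [← hM, hph, hM, hLe, hLe])
    (L (1, 0))
  have h5 : Le.symm (L (1, 0)) = (1, 0) := Le.symm_apply_apply _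
  simp only [h5] at htriv
  have h6 := hL.1 htriv
  simp only [ph, mul_one] at h6
  exact hω1 (Prod.mk.inj h6).1

lemma fix_of_coprime [Fintype K] {m k : ℕ} (hcard : Fintype.card K = 2 ^ m) (hg : Nat.gcd k m = 1)
    (t : K) (ht : iterateFrobenius K 2 k t = t) : t = 0 ∨ t = 1 := by
  have a1 : Function.IsPeriodicPt (frobenius K 2) k t := by
    unfold Function.IsPeriodicPt Function.IsFixedPt
    rw [← coe_iterateFrobenius]; exact ht
  have a2 : Function.IsPeriodicPt (frobenius K 2) m t := by
    unfold Function.IsPeriodicPt Function.IsFixedPt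
    rw [← coe_iterateFrobenius, iterateFrobenius_def, ← hcard]; exact FiniteField.pow_card t
  have a3 := a1.gcd a2
  rw [hg] at a3
  have a4 : t ^ 2 = t := by
    have : frobenius K 2 t = t := a3
    rwa [frobenius_def] at this
  have : t * (t - 1) = 0 := by linear_combination a4
  rcases mul_eq_zero.mp this with h | h
  · exact Or.inl h
  · exact Or.inr (sub_eq_zero.mp h)

lemma exists_gen [Fintype K] {m : ℕ} (hcard : Fintype.card K = 2 ^ m) :
    ∃ t : K, t ≠ 0 ∧ orderOf t = 2 ^ m - 1 := by
  obtain ⟨g, hg⟩ := IsCyclic.exists_ofOrder_eq_natCard (α := Kˣ)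
  refine ⟨g, g.ne_zero, ?_⟩
  rw [orderOf_units, hg, Nat.card_units, Nat.card_eq_fintype_card, hcard]

lemma pow_mod [Fintype K] {m : ℕ} (hcard : Fintype.card K = 2 ^ m) (i : ℕ) (t : K) :
    t ^ 2 ^ i = t ^ 2 ^ (i % m) := by
  conv_lhs => rw [← Nat.mod_add_div i m, pow_add, pow_mul, pow_mul 2 m, ← hcard]
  exact FiniteField.pow_card_pow _ _

lemma exists_H3 [Fintype K] {m : ℕ} (hm : 4 ≤ m) (hcard : Fintype.card K = 2 ^ m) (k : ℕ) :
    ∃ t : K, t ≠ 0 ∧ iterateFrobenius K 2 k t * t ≠ 1 ∧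
      iterateFrobenius K 2 k (iterateFrobenius K 2 k t) * t ≠ 1 := by
  obtain ⟨t, ht, ho⟩ := exists_gen hcard
  have key : ∀ i, t ^ 2 ^ i * t ≠ 1 := by
    intro i h
    rw [pow_mod hcard, ← pow_succ] at h
    have hd := orderOf_dvd_of_pow_eq_one h
    rw [ho] at hd
    have hle := Nat.le_of_dvd (Nat.succ_pos _) hd
    have hlt : i % m < m := Nat.mod_lt _ (by omega)
    have h1 : 2 ^ (i % m) ≤ 2 ^ (m - 1) := Nat.pow_le_pow_right (by norm_num) (by omega)
    have h2 : 2 ^ m = 2 * 2 ^ (m - 1) := by rw [← pow_succ']; congr 1; omega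
    have h3 : 2 ^ 2 ≤ 2 ^ (m - 1) := Nat.pow_le_pow_right (by norm_num) (by omega)
    omega
  refine ⟨t, ht, ?_, ?_⟩
  · rw [iterateFrobenius_def]; exact key k
  · rw [iterateFrobenius_def, iterateFrobenius_def, ← pow_mul, ← pow_add]; exact key _

lemma exists_H4 [Fintype K] {m k : ℕ} (hm : 4 ≤ m) (hcard : Fintype.card K = 2 ^ m)
    (heven : Even m) (hk : Odd k) :
    ∃ ω : K, ω ≠ 1 ∧ iterateFrobenius K 2 k ω * ω = 1 := by
  obtain ⟨t, ht, ho⟩ := exists_gen hcard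
  obtain ⟨j, rfl⟩ := heven
  obtain ⟨i, rfl⟩ := hk
  have h3 : 3 ∣ 2 ^ (j + j) - 1 := by
    have := Nat.sub_dvd_pow_sub_pow 4 1 j
    rw [one_pow] at this
    rw [← two_mul, pow_mul]
    exact this
  have h3' : 3 ∣ 2 ^ (2 * i + 1) + 1 := by
    have := Nat.sub_dvd_pow_sub_pow 4 1 i
    rw [one_pow] at this
    rw [pow_succ, pow_mul]
    have h1 : 1 ≤ (2 ^ 2) ^ i := Nat.one_le_pow _ _ (by norm_num)
    norm_num at this h1 ⊢
    omega
  obtain ⟨e, he⟩ := h3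
  have hpow : 2 ^ 4 ≤ 2 ^ (j + j) := Nat.pow_le_pow_right (by norm_num) hm
  refine ⟨t ^ e, ?_, ?_⟩
  · intro h
    have hd := orderOf_dvd_of_pow_eq_one h
    rw [ho, he] at hd
    have := Nat.le_of_dvd (by omega) hd
    omega
  · obtain ⟨r, hr⟩ := h3'
    rw [iterateFrobenius_def, ← pow_succ, hr, ← pow_mul, ← mul_assoc, mul_comm e 3, ← he, ← ho,
      pow_mul, pow_orderOf_eq_one, one_pow]

lemma ind_frob [Fintype K] {m k : ℕ} (hm : 4 ≤ m) (hcard : Fintype.card K = 2 ^ m)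
    (hg : Nat.gcd k m = 1) (c0 c1 c2 c3 : K)
    (h : ∀ x, c0 * x + c1 * iterateFrobenius K 2 k x +
      c2 * iterateFrobenius K 2 k (iterateFrobenius K 2 k x) +
      c3 * iterateFrobenius K 2 k (iterateFrobenius K 2 k (iterateFrobenius K 2 k x)) = 0) :
      c0 = 0 ∧ c1 = 0 ∧ c2 = 0 ∧ c3 = 0 := by
  let F : Fin 4 → (K →* K) := fun i => (iterateFrobenius K 2 (k * i) : K →* K)
  have hF : ∀ i x, F i x = x ^ 2 ^ (k * i) := fun i x => iterateFrobenius_def _ _ _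
  have hinj : Function.Injective F := by
    intro i j hij
    obtain ⟨t, ht, ho⟩ := exists_gen hcard
    have e := DFunLike.congr_fun hij t
    rw [hF, hF, pow_mod hcard, pow_mod hcard (k * j)] at e
    have hlt : ∀ n, 2 ^ (n % m) < orderOf t := by
      intro n
      have hlt : n % m < m := Nat.mod_lt _ (by omega)
      have h1 : 2 ^ (n % m) ≤ 2 ^ (m - 1) := Nat.pow_le_pow_right (by norm_num) (by omega)
      have h2 : 2 ^ m = 2 * 2 ^ (m - 1) := by rw [← pow_succ']; congr 1; omega
      have h3 : 2 ^ 2 ≤ 2 ^ (m - 1) := Nat.pow_le_pow_right (by norm_num) (by omega)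
      omega
    have e1 := pow_injOn_Iio_orderOf (hlt _) (hlt _) e
    have e2 : k * i ≡ k * j [MOD m] := Nat.pow_right_injective (le_refl 2) e1
    have e3 : (i : ℕ) ≡ j [MOD m] :=
      Nat.ModEq.cancel_left_of_coprime (by rw [Nat.gcd_comm]; exact hg) e2
    have : (i : ℕ) = j := Nat.ModEq.eq_of_lt_of_lt e3 (by omega) (by omega)
    exact Fin.ext this
  have hli := (linearIndependent_monoidHom K K).comp F hinj
  rw [Fintype.linearIndependent_iff] at hli
  have := hli ![c0, c1, c2, c3] (by
    funext x
    have hx := h x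
    simp only [iterateFrobenius_def, ← pow_mul, ← pow_add] at hx
    simp only [Fin.sum_univ_four, Function.comp, Pi.add_apply, Pi.smul_apply, hF, smul_eq_mul,
      Pi.zero_apply]
    simp
    rw [← hx]
    ring_nf)
  exact ⟨this 0, this 1, this 2, this 3⟩

lemma taniguchi_eq (k : ℕ) (α β : K) : taniguchi k α β = T (iterateFrobenius K 2 k) α β := by
  funext p
  simp only [taniguchi, T, iterateFrobenius_def]
  ext
  · simp only
    congr 1
    · congr 1
      · ring
      · ring
    · ring
  · rfl

end field
end TaniAux

/-- For even `m ≥ 4`, two APN Taniguchi functions `f_{k,0,β}` and `f_{ℓ,α',β'}` with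
`α' ≠ 0` on `F_{2^m} × F_{2^m}` are CCZ-inequivalent. -/
theorem taniguchi_alpha_zero_nonzero_inequivalent (m k ℓ : ℕ) (hm : 4 ≤ m)
    (hmeven : Even m)
    (hk : 0 < k) (hkm : k < m) (hgk : Nat.gcd k m = 1)
    (hℓ : 0 < ℓ) (hℓm : ℓ < m) (hgl : Nat.gcd ℓ m = 1)
    (β α' β' : GaloisField 2 m) (hβ : β ≠ 0) (hα' : α' ≠ 0) (hβ' : β' ≠ 0)
    (hAPN₁ : ∀ x : GaloisField 2 m,
      x ^ (2 ^ k + 1) + (0 : GaloisField 2 m) * x + β ≠ 0)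
    (hAPN₂ : ∀ x : GaloisField 2 m, x ^ (2 ^ ℓ + 1) + α' * x + β' ≠ 0) :
    ¬ CCZEquivalent (taniguchi k (0 : GaloisField 2 m) β) (taniguchi ℓ α' β') := by
  have hm0 : m ≠ 0 := by omega
  letI : Fintype (GaloisField 2 m) := Fintype.ofFinite _
  have hcard : Fintype.card (GaloisField 2 m) = 2 ^ m := by
    rw [← Nat.card_eq_fintype_card]; exact GaloisField.card 2 m hm0
  have hkodd : Odd k := by
    by_contra hc
    rw [Nat.not_odd_iff_even] at hc
    have := Nat.dvd_gcd hc.two_dvd hmeven.two_dvd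
    rw [hgk] at this
    omega
  rw [TaniAux.taniguchi_eq, TaniAux.taniguchi_eq]
  apply TaniAux.main_abstract _ _ β α' β' m (by omega) hcard hβ' hα'
    (TaniAux.fix_of_coprime hcard hgk) (TaniAux.fix_of_coprime hcard hgl)
    (TaniAux.exists_H3 hm hcard k) (TaniAux.exists_H4 hm hcard hmeven hkodd)
    (TaniAux.ind_frob hm hcard hgl)
  · intro x
    rw [iterateFrobenius_def, ← pow_succ]
    exact hAPN₁ x
  · intro x
    rw [iterateFrobenius_def, ← pow_succ]
    exact hAPN₂ x
end

section
/- Let k and m be positive integers with gcd(k,m) = 1, and write m = 3r for a positive integer r. Let β be an element of the subfield F_{2^r} of F_{2^m} (i.e. β^{2^r} = β), and suppose the polynomial P(X) = X^{2^k+1} + X + β has no root in F_{2^r}. Then P(X) has exactly three roots in F_{2^m}. -/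
lemma ringEnd_mul_apply {F : Type*} [Field F] (f g : F →+* F) (x : F) : (f * g) x = f (g x) := rfl

open Matrix in
/-- The iterates `B_{i+1} = C * σ(B_i)`. -/
def iterB {F : Type*} [Field F] (σ : F →+* F) (C : Matrix (Fin 2) (Fin 2) F) :
    ℕ → Matrix (Fin 2) (Fin 2) F
  | 0 => 1
  | (n+1) => C * (iterB σ C n).map σ

lemma iterB_right {F : Type*} [Field F] (σ : F →+* F) (C : Matrix (Fin 2) (Fin 2) F) (i : ℕ) :
    iterB σ C (i+1) = iterB σ C i * C.map (σ^i : F →+* F) := by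
  induction i with
  | zero => ext i j; simp [iterB, Matrix.map_one]
  | succ n ih =>
    rw [iterB, ih, Matrix.map_mul, ← mul_assoc, ← iterB]
    congr 1
    ext a b
    simp [pow_succ']

lemma iterB_add {F : Type*} [Field F] (σ : F →+* F) (C : Matrix (Fin 2) (Fin 2) F) (r i : ℕ) :
    iterB σ C (i+r) = iterB σ C i * (iterB σ C r).map (σ^i : F →+* F) := by
  induction i with
  | zero => ext i j; simp [iterB]
  | succ n ih =>
    rw [show n + 1 + r = (n + r) + 1 by ring, iterB, ih, Matrix.map_mul, ← mul_assoc, ← iterB]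
    congr 1
    ext a b
    simp [pow_succ']

lemma iterB_fix {F : Type*} [Field F] (σ : F →+* F) (C : Matrix (Fin 2) (Fin 2) F) (r : ℕ)
    (hC : C.map (σ^r : F →+* F) = C) (i : ℕ) :
    (iterB σ C i).map (σ^r : F →+* F) = iterB σ C i := by
  induction i with
  | zero => simp [iterB, Matrix.map_one]
  | succ n ih =>
    rw [iterB, Matrix.map_mul, hC]
    congr 1
    conv_rhs => rw [← ih]
    ext a b
    simp only [Matrix.map_apply]
    rw [← ringEnd_mul_apply, ← ringEnd_mul_apply, ← pow_succ, ← pow_succ']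

lemma iterB_det {F : Type*} [Field F] (σ : F →+* F) (C : Matrix (Fin 2) (Fin 2) F)
    (hC : C.det ≠ 0) (i : ℕ) : (iterB σ C i).det ≠ 0 := by
  induction i with
  | zero => simp [iterB]
  | succ n ih =>
    rw [iterB, Matrix.det_mul]
    have : ((iterB σ C n).map σ).det = σ (iterB σ C n).det := by
      rw [RingHom.map_det]; rfl
    rw [this]
    exact mul_ne_zero hC (by simpa using ih)

/-- Averaging plus independence of characters. -/
lemma exists_avg {F : Type*} [Field F] (σ : F →+* F) (m : ℕ) (hm : 0 < m)
    (hinj : ∀ i < m, ∀ j < m, σ^i = σ^j → i = j) (a : ℕ → F) (ha : a 0 ≠ 0) :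
    ∃ c : F, ∑ i ∈ Finset.range m, (σ^i) c * a i ≠ 0 := by
  by_contra! h
  have hli := linearIndependent_monoidHom F F
  have hinj' : Function.Injective (fun i : Fin m => ((σ^(i:ℕ) : F →+* F) : F →* F)) := by
    intro i j hij
    apply Fin.ext
    apply hinj i i.2 j j.2
    ext x
    exact DFunLike.congr_fun hij x
  have := hli.comp _ hinj'
  rw [Fintype.linearIndependent_iff] at this
  have h2 := this (fun i => a i) (by
    ext c
    have := h c
    rw [Finset.sum_range] at this
    simpa [Finset.sum_apply, mul_comm] using this) ⟨0, hm⟩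
  exact ha h2

lemma matrix_cube {F : Type*} [Field F] [CharP F 2] (σ : F →+* F) (r : ℕ)
    (hfix : ∀ x, σ x = x → x = 0 ∨ x = 1)
    (β : F) (hβ0 : β ≠ 0)
    (hno : ∀ x, (σ^r) x = x → σ x * x + x + β ≠ 0)
    (M : Matrix (Fin 2) (Fin 2) F) (hMdet : M.det ≠ 0)
    (hMr : M.map (σ^r : F →+* F) = M)
    (hconj : !![1/β, 1/β; 1, 0] * M.map σ = M * !![1/β, 1/β; 1, 0]) :
    M ^ 3 = 1 := by
  have h2 : (2:F) = 0 := CharTwo.two_eq_zero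
  obtain ⟨p, q, s, t, rfl⟩ : ∃ p q s t, M = !![p, q; s, t] :=
    ⟨_, _, _, _, Matrix.eta_fin_two M⟩
  rw [Matrix.det_fin_two_of] at hMdet
  have e := fun i j => congrFun (congrFun hconj i) j
  have e00 := e 0 0
  have e01 := e 0 1
  have e10 := e 1 0
  have e11 := e 1 1
  have f := fun i j => congrFun (congrFun hMr i) j
  have f01 : (σ^r) q = q := f 0 1
  have f10 : (σ^r) s = s := f 1 0
  have f11 : (σ^r) t = t := f 1 1
  simp [Matrix.mul_apply, Fin.sum_univ_two] at e00 e01 e10 e11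
  clear e f hconj hMr
  field_simp at e00 e01 e10 e11
  have htr : p + t = 0 ∨ p + t = 1 := hfix _ (by rw [map_add]; grind)
  have hdet : p * t - q * s = 1 := by
    refine (hfix _ ?_).resolve_left hMdet
    simp only [map_sub, map_mul]
    grind
  -- a fixed line gives a root
  have key : ∀ a b : F, (a ≠ 0 ∨ b ≠ 0) → (σ^r) a = a → (σ^r) b = b →
      β * (a * σ a) + b * σ a + b * σ b = 0 → False := by
    intro a b hab ha hb h
    have ha0 : a ≠ 0 := by
      rintro rfl
      simp at h hab
      exact hab h
    have hsa : σ a ≠ 0 := by simpa using ha0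
    apply hno (b / a) (by rw [map_div₀, ha, hb])
    rw [map_div₀]
    field_simp
    linear_combination h
  have hcube : p + t = 1 → !![p, q; s, t] ^ 3 = 1 := by
    intro htr
    rw [pow_succ, pow_two, Matrix.one_fin_two]
    simp only [Matrix.mul_fin_two]
    have : t = 1 + p := by grind
    subst this
    ext i j
    fin_cases i <;> fin_cases j <;> simp <;> grind
  rcases htr with htr | htr
  · have htp : t = p := by grind
    subst htp
    by_cases hc : t + 1 = 0 ∧ s = 0 
    · by_cases hd : q = 0
      · obtain ⟨h1, h3⟩ := hc
        have : t = 1 := by grind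
        subst this; subst hd; subst h3
        rw [← Matrix.one_fin_two, one_pow]
      · exfalso
        apply key q (t+1) (Or.inl hd) f01 (by rw [map_add, f11, map_one])
        rw [map_add, map_one]
        grind
    · exfalso
      apply key (t+1) s (by tauto) (by rw [map_add, f11, map_one]) f10
      rw [map_add, map_one]
      grind
  · exact hcube htr

lemma three_roots_abstract {F : Type*} [Field F] [CharP F 2] (σ : F →+* F) (r : ℕ) (hr : 0 < r)
    (hfix : ∀ x, σ x = x → x = 0 ∨ x = 1)
    (hone : σ ^ (3 * r) = 1)
    (hinj : ∀ i < 3 * r, ∀ j < 3 * r, σ^i = σ^j → i = j)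
    (β : F) (hβ : (σ^r) β = β)
    (hno : ∀ x, (σ^r) x = x → σ x * x + x + β ≠ 0) :
    {x : F | σ x * x + x + β = 0}.ncard = 3 := by
  have h2 : (2:F) = 0 := CharTwo.two_eq_zero
  have hβ0 : β ≠ 0 := by
    rintro rfl
    exact hno 0 (by simp) (by simp)
  set C : Matrix (Fin 2) (Fin 2) F := !![1/β, 1/β; 1, 0] with hC
  have hCdet : C.det ≠ 0 := by simp [hC, Matrix.det_fin_two_of, hβ0]
  have hCr : C.map (σ^r : F →+* F) = C := by
    ext i j
    have hβi : (σ^r) (1/β) = 1/β := by rw [map_div₀, map_one, hβ]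
    fin_cases i <;> fin_cases j
    · exact hβi
    · exact hβi
    · exact map_one (σ^r)
    · exact map_zero (σ^r)
  have hMr := iterB_fix σ C r hCr r
  have hM3 : iterB σ C r ^ 3 = 1 := by
    apply matrix_cube σ r hfix β hβ0 hno _ (iterB_det σ C hCdet r) hMr
    have := iterB_right σ C r
    rw [hCr, iterB] at this
    exact this
  have hB : iterB σ C (3 * r) = 1 := by
    rw [show 3 * r = r + (r + r) by ring, iterB_add, iterB_add, Matrix.map_mul]
    simp only [hMr]
    rw [← hM3, pow_succ, pow_two, mul_assoc]
  have hBs : ∀ i j, β * iterB σ C (i+1) 0 j + iterB σ C (i+1) 1 j = σ (iterB σ C i 1 j) ∧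
      iterB σ C (i+1) 1 j = σ (iterB σ C i 0 j) := by
    intro i j
    rw [iterB]
    simp [hC, Matrix.mul_apply, Fin.sum_univ_two]
    field_simp
    grind
  -- fixed vectors
  have hw : ∀ (j : Fin 2) (c : F) (l : Fin 2),
      σ (∑ i ∈ Finset.range (3*r), (σ^i) c * iterB σ C i l j) =
      ∑ i ∈ Finset.range (3*r), (σ^(i+1)) c * σ (iterB σ C i l j) := by
    intro j c l
    rw [map_sum]
    refine Finset.sum_congr rfl fun i _ => ?_
    rw [map_mul, pow_succ']; rfl
  have hshift : ∀ (j : Fin 2) (c : F) (l : Fin 2),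
      ∑ i ∈ Finset.range (3*r), (σ^(i+1)) c * iterB σ C (i+1) l j =
      ∑ i ∈ Finset.range (3*r), (σ^i) c * iterB σ C i l j := by
    intro j c l
    have h1 := Finset.sum_range_succ (fun i => (σ^i) c * iterB σ C i l j) (3*r)
    have h3 := Finset.sum_range_succ' (fun i => (σ^i) c * iterB σ C i l j) (3*r)
    rw [h1] at h3
    simp only [hone, hB] at h3
    simp only [pow_zero, iterB] at h3
    exact (add_right_cancel h3).symm
  have hfixv : ∀ (j : Fin 2) (c : F), ∃ z : F, 
      z = ∑ i ∈ Finset.range (3*r), (σ^i) c * iterB σ C i 0 j ∧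
      σ z = ∑ i ∈ Finset.range (3*r), (σ^i) c * iterB σ C i 1 j ∧
      σ (σ z) = σ z + β * z := by
    intro j c
    have hz : σ (∑ i ∈ Finset.range (3*r), (σ^i) c * iterB σ C i 0 j) =
        ∑ i ∈ Finset.range (3*r), (σ^i) c * iterB σ C i 1 j := by
      rw [hw, ← hshift j c 1]
      exact Finset.sum_congr rfl fun i _ => by rw [(hBs i j).2]
    refine ⟨_, rfl, hz, ?_⟩
    rw [hz, hw, ← hshift j c 1, ← hshift j c 0, Finset.mul_sum, ← Finset.sum_add_distrib]
    exact Finset.sum_congr rfl fun i _ => by rw [← (hBs i j).1]; ring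
  have hroot : ∀ z : F, z ≠ 0 → σ (σ z) = σ z + β * z →
      σ (σ z / z) * (σ z / z) + σ z / z + β = 0 := by
    intro z hz h
    have hsz : σ z ≠ 0 := by simpa using hz
    rw [map_div₀, h]
    field_simp
    grind
  obtain ⟨c0, hc0⟩ := exists_avg σ (3*r) (by omega) hinj (fun i => iterB σ C i 0 0)
    (by simp [iterB])
  obtain ⟨z0, hz0, hz0', hz0r⟩ := hfixv 0 c0
  have hz0n : z0 ≠ 0 := by rw [hz0]; exact hc0
  obtain ⟨c1, hc1⟩ := exists_avg σ (3*r) (by omega) hinj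
    (fun i => iterB σ C i 1 1 - (σ z0 / z0) * iterB σ C i 0 1) (by simp [iterB])
  obtain ⟨z1, hz1, hz1', hz1r⟩ := hfixv 1 c1
  have hne : σ z1 - (σ z0 / z0) * z1 ≠ 0 := by
    rw [hz1', hz1, Finset.mul_sum, ← Finset.sum_sub_distrib]
    convert hc1 using 2
    ring
  have hz1n : z1 ≠ 0 := by
    rintro h; apply hne; rw [h]; simp
  have hne' : σ z1 * z0 - σ z0 * z1 ≠ 0 := by
    intro h; apply hne; field_simp; rw [h, mul_zero]
  have hz2n : z0 + z1 ≠ 0 := by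
    intro h
    have : z1 = z0 := by grind
    apply hne'; rw [this]; ring
  have hz2r : σ (σ (z0 + z1)) = σ (z0 + z1) + β * (z0 + z1) := by
    simp only [map_add]; grind
  have r0 := hroot z0 hz0n hz0r
  have r1 := hroot z1 hz1n hz1r
  have r2 := hroot _ hz2n hz2r
  have n01 : σ z0 / z0 ≠ σ z1 / z1 := by
    intro h; rw [div_eq_div_iff hz0n hz1n] at h; apply hne'; rw [h]; ring
  have n02 : σ z0 / z0 ≠ σ (z0 + z1) / (z0 + z1) := by
    intro h; rw [div_eq_div_iff hz0n hz2n, map_add] at h; apply hne'; linear_combination -h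
  have n12 : σ z1 / z1 ≠ σ (z0 + z1) / (z0 + z1) := by
    intro h; rw [div_eq_div_iff hz1n hz2n, map_add] at h; apply hne'; linear_combination h
  generalize σ z0 / z0 = x0 at *
  generalize σ z1 / z1 = x1 at *
  generalize σ (z0 + z1) / (z0 + z1) = x2 at *
  rw [Set.ncard_eq_three]
  refine ⟨x0, x1, x2, n01, n02, n12, ?_⟩
  have hnz : ∀ x, σ x * x + x + β = 0 → x ≠ 0 ∧ σ x = 1 + β / x := by
    intro x hx
    have : x ≠ 0 := by rintro rfl; simp at hx; exact hβ0 hx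
    refine ⟨this, ?_⟩
    field_simp
    grind
  ext x
  simp only [Set.mem_ofPred_eq, Set.mem_insert_iff, Set.mem_singleton_iff]
  constructor
  · intro hx
    by_cases hx1 : x = x1
    · exact Or.inr (Or.inl hx1)
    obtain ⟨a, a'⟩ := hnz x hx
    obtain ⟨b0, b0'⟩ := hnz x0 r0
    obtain ⟨b1, b1'⟩ := hnz x1 r1
    obtain ⟨b2, b2'⟩ := hnz x2 r2
    have hd : ∀ u v : F, u ≠ 0 → v ≠ 0 → σ u = 1 + β / u → σ v = 1 + β / v →
        σ (u - v) = β / (u * v) * (v - u) := by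
      intro u v hu hv h h'
      rw [map_sub, h, h']; field_simp; ring
    have s1 : x - x1 ≠ 0 := sub_ne_zero.2 hx1
    have s2 : x2 - x0 ≠ 0 := sub_ne_zero.2 n02.symm
    have s1' : x1 - x ≠ 0 := sub_ne_zero.2 (Ne.symm hx1)
    have s2' : x0 - x2 ≠ 0 := sub_ne_zero.2 n02
    have s3 : x2 - x1 ≠ 0 := sub_ne_zero.2 n12.symm
    rcases hfix ((x - x0) * (x2 - x1) / ((x - x1) * (x2 - x0))) (by
      rw [map_div₀, map_mul, map_mul, hd _ _ a b0 a' b0', hd _ _ b2 b1 b2' b1',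
        hd _ _ a b1 a' b1', hd _ _ b2 b0 b2' b0']
      rw [div_eq_div_iff (by simp [*]) (by simp [*])]
      field_simp
      ring) with h | h
    · left
      rw [div_eq_zero_iff] at h
      rcases h with h | h
      · exact sub_eq_zero.1 ((mul_eq_zero.1 h).resolve_right s3)
      · exact absurd h (mul_ne_zero s1 s2)
    · right; right
      rw [div_eq_one_iff_eq (mul_ne_zero s1 s2)] at h
      have : (x - x2) * (x1 - x0) = 0 := by linear_combination -h
      exact sub_eq_zero.1 ((mul_eq_zero.1 this).resolve_right (sub_ne_zero.2 n01.symm))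
  · rintro (rfl | rfl | rfl) <;> assumption

lemma iterFrob_pow {F : Type*} [Field F] [CharP F 2] (k n : ℕ) (x : F) :
    ((iterateFrobenius F 2 k)^n : F →+* F) x = x ^ 2 ^ (k * n) := by
  induction n with
  | zero => simp
  | succ n ih =>
    rw [pow_succ', ringEnd_mul_apply, ih, iterateFrobenius_def, ← pow_mul, ← pow_add]
    congr 2

lemma pow_two_gcd {F : Type*} [Field F] (x : F) (a b : ℕ) (ha : x ^ 2 ^ a = x)
    (hb : x ^ 2 ^ b = x) : x ^ 2 ^ (Nat.gcd a b) = x := by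
  have key : ∀ n, (fun y : F => y ^ 2)^[n] x = x ^ 2 ^ n := by
    intro n
    induction n with
    | zero => simp
    | succ n ih => rw [Function.iterate_succ_apply', ih, ← pow_mul, pow_succ]
  have h1 : Function.IsPeriodicPt (fun y : F => y ^ 2) a x := (key a).trans ha
  have h2 : Function.IsPeriodicPt (fun y : F => y ^ 2) b x := (key b).trans hb
  exact (key _).symm.trans (h1.gcd h2)


/-- Let `gcd(k, m) = 1` with `m = 3r`.  If `β` lies in the subfield `F_{2^r}` of
`F_{2^m}` and `P(X) = X^(2^k+1) + X + β` has no root in `F_{2^r}`, then `P(X)` has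
exactly three roots in `F_{2^m}`. -/
theorem three_roots_in_cubic_extension (k r : ℕ) (hk : 0 < k) (hr : 0 < r)
    (hgcd : Nat.gcd k (3 * r) = 1)
    (β : GaloisField 2 (3 * r)) (hβ : β ^ 2 ^ r = β)
    (hnoroot : ∀ x : GaloisField 2 (3 * r),
      x ^ 2 ^ r = x → x ^ (2 ^ k + 1) + x + β ≠ 0) :
    {x : GaloisField 2 (3 * r) | x ^ (2 ^ k + 1) + x + β = 0}.ncard = 3 := by
  have hcard : Nat.card (GaloisField 2 (3 * r)) = 2 ^ (3 * r) := GaloisField.card 2 _ (by omega)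
  have : Finite (GaloisField 2 (3 * r)) := Nat.finite_of_card_ne_zero (by rw [hcard]; positivity)
  have : Fintype (GaloisField 2 (3 * r)) := Fintype.ofFinite _
  have hcard' : Fintype.card (GaloisField 2 (3 * r)) = 2 ^ (3 * r) := by
    rw [← Nat.card_eq_fintype_card, hcard]
  have hall : ∀ x : GaloisField 2 (3 * r), x ^ 2 ^ (3 * r) = x := by
    intro x
    rw [← hcard']; exact FiniteField.pow_card x
  have hper : ∀ (n : ℕ) (x : GaloisField 2 (3 * r)), x ^ 2 ^ (k * n) = x →
      x ^ 2 ^ (Nat.gcd n (3 * r)) = x := by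
    intro n x hx
    have := pow_two_gcd x _ _ hx (hall x)
    rwa [Nat.Coprime.gcd_mul_left_cancel n hgcd] at this
  have hpow : ∀ (x : GaloisField 2 (3 * r)), x ^ (2 ^ k + 1) + x + β =
      iterateFrobenius _ 2 k x * x + x + β := by
    intro x
    rw [iterateFrobenius_def, pow_succ]
  have hmul : ∀ (a n : ℕ) (x : GaloisField 2 (3 * r)), x ^ 2 ^ a = x → x ^ 2 ^ (n * a) = x := by
    intro a n x hx
    induction n with
    | zero => simp
    | succ n ih => rw [Nat.succ_mul n a, pow_add, pow_mul, ih, hx]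
  simp only [hpow] at hnoroot ⊢
  apply three_roots_abstract (iterateFrobenius (GaloisField 2 (3 * r)) 2 k) r hr
  · intro x hx
    rw [iterateFrobenius_def] at hx
    have := hper 1 x (by simpa using hx)
    simp at this
    have h : x * (x - 1) = 0 := by linear_combination this
    rcases mul_eq_zero.1 h with h | h
    · exact Or.inl h
    · exact Or.inr (sub_eq_zero.1 h)
  · ext x
    rw [iterFrob_pow, hmul _ _ _ (hall x)]; rfl
  · have main : ∀ i j, i < j → j < 3 * r →
        iterateFrobenius (GaloisField 2 (3 * r)) 2 k ^ i ≠
          iterateFrobenius (GaloisField 2 (3 * r)) 2 k ^ j := by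
      intro i j hij hj h
      have hd : ∀ x : GaloisField 2 (3 * r), x ^ 2 ^ (k * (j - i)) = x := by
        intro x
        have h1 := DFunLike.congr_fun h x
        rw [show j = i + (j - i) by omega, pow_add, ringEnd_mul_apply, iterFrob_pow k (j - i)] at h1
        exact (RingHom.injective _ h1).symm
      have hg := fun x => hper _ x (hd x)
      have hglt : Nat.gcd (j - i) (3 * r) < 3 * r :=
        lt_of_le_of_lt (Nat.gcd_le_left _ (by omega)) (by omega)
      have hgpos : 0 < Nat.gcd (j - i) (3 * r) := Nat.gcd_pos_of_pos_left _ (by omega)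
      have h1 : 1 < 2 ^ Nat.gcd (j - i) (3 * r) := Nat.one_lt_two_pow (by omega)
      have hne := FiniteField.X_pow_card_sub_X_ne_zero (GaloisField 2 (3 * r)) h1
      have hle := Polynomial.card_roots' (Polynomial.X ^ (2 ^ Nat.gcd (j - i) (3 * r)) -
        Polynomial.X : Polynomial (GaloisField 2 (3 * r)))
      rw [FiniteField.X_pow_card_sub_X_natDegree_eq _ h1] at hle
      have hsub : (Finset.univ : Finset (GaloisField 2 (3 * r))).val ≤ (Polynomial.X ^ (2 ^ Nat.gcd (j - i) (3 * r)) -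
        Polynomial.X : Polynomial (GaloisField 2 (3 * r))).roots := by
        rw [Multiset.le_iff_subset Finset.univ.nodup]
        intro x _
        rw [Polynomial.mem_roots hne]
        simp [hg x]
      have h3 := Multiset.card_le_card hsub
      rw [Finset.card_val, Finset.card_univ, hcard'] at h3
      have := Nat.pow_lt_pow_right (show 1 < 2 by norm_num) hglt
      omega
    intro i hi j hj h
    rcases lt_trichotomy i j with h' | h' | h'
    · exact absurd h (main i j h' hj)
    · exact h'
    · exact absurd h.symm (main j i h' hi)
  · rw [iterFrob_pow, hmul _ _ _ hβ]
  · intro x hx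
    rw [iterFrob_pow] at hx
    apply hnoroot
    have := hper r x hx
    rwa [Nat.gcd_mul_left_right] at this
end
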